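/- Let (Ω, 𝓕, 𝔽, P) satisfy the usual conditions, and let X_t = Σ_{k=1}^∞ 1_{{τ_k ≤ t}} be a counting process with 0 < τ_1 < τ_2 < ⋯ P-a.s. Let 𝔸^k be the natural filtration of (1_{{τ_k ≤ t}})_{t≥0}, let 𝔾^0 := 𝔽, 𝔾^k the right-continuous regularization of (𝓕_t ∨ 𝓐^1_t ∨ ⋯ ∨ 𝓐^k_t)_{t≥0}, and 𝔾 the right-continuous regularization of (𝓕_t ∨ ⋁_{i=1}^∞ 𝓐^i_t)_{t≥0}. Assume: (i) 𝔽 = 𝔾^0 ↪ 𝔾^1 ↪ ⋯ ↪ 𝔾^k ↪ ⋯ ↪ 𝔾 (each filtration is immersed in the next and in 𝔾); (ii) for each k ≥ 1, the process Z^k_t := P(τ_k > t | 𝓖^{k-1}_t) has a continuous, strictly positive modification. Let 0 < L < U, η progressively measurable with L ≤ η ≤ U (P ⊗ dt)-a.e., λ : [0,∞) × ℕ → [0,∞) measurable with L ≤ λ(·, x) ≤ U a.e. for each x, and suppose X_t − ∫_0^t (η_s / E[η_s | X_{s−}]) λ(s, X_{s−}) ds is a 𝔾-martingale. Define γ_k(t)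 := E[η_t | X_{t−} = k] = E[η_t 1_{{X_{t−}=k}}] / P(X_{t−} = k), and E_k := ∫_{τ_{k-1}}^{τ_k} (η_s / γ_{k-1}(s)) λ(s, k−1) ds (with τ_0 := 0). Then the random variables (E_k)_{k≥1} are i.i.d. with the Exp(1) distribution and independent of 𝓕_∞, and P-a.s., for every k ≥ 1, τ_k = inf{t > τ_{k-1} : ∫_{τ_{k-1}}^t (η_s / γ_{k-1}(s)) λ(s, k−1) ds ≥ E_k}. -/

import Mathlib

open MeasureTheory ProbabilityTheory Filter Set
open scoped ENNReal Topology

noncomputable section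

namespace InvMarkovJump

variable {Ω : Type*}

/-- `F` is a filtration (for times `t ≥ 0`) of sub-σ-algebras of `m0`. -/
def IsFiltration (m0 : MeasurableSpace Ω) (F : ℝ → MeasurableSpace Ω) : Prop :=
  (∀ s t : ℝ, 0 ≤ s → s ≤ t → F s ≤ F t) ∧ ∀ t : ℝ, F t ≤ m0

/-- The right-continuous regularization `(⋂_{s > t} F s)_{t ≥ 0}` of a filtration. -/
def rcReg (F : ℝ → MeasurableSpace Ω) : ℝ → MeasurableSpace Ω :=
  fun t => ⨅ s ∈ Set.Ioi t, F s

/-- All sample paths of `M` are right-continuous (at every time `t ≥ 0`). -/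
def RCPaths (M : ℝ → Ω → ℝ) : Prop :=
  ∀ ω, ∀ t : ℝ, 0 ≤ t → ContinuousWithinAt (fun s => M s ω) (Set.Ici t) t

/-- `M` is a martingale (for times `t ≥ 0`) with respect to the filtration `F`
under the measure `μ`: it is adapted, integrable, and `E[M_t | F_s] = M_s` a.s.
for all `0 ≤ s ≤ t`. -/
def IsMartingale {m0 : MeasurableSpace Ω} (μ : Measure Ω)
    (F : ℝ → MeasurableSpace Ω) (M : ℝ → Ω → ℝ) : Prop :=
  (∀ t : ℝ, 0 ≤ t → Integrable (M t) μ) ∧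
  (∀ t : ℝ, 0 ≤ t → Measurable[F t] (M t)) ∧
  ∀ s t : ℝ, 0 ≤ s → s ≤ t → μ[M t|F s] =ᵐ[μ] M s

/-- `F` is immersed in `G`: `F ⊆ G` and every `F`-martingale (with right-continuous
sample paths) is a `G`-martingale. -/
def Immersed {m0 : MeasurableSpace Ω} (μ : Measure Ω)
    (F G : ℝ → MeasurableSpace Ω) : Prop :=
  (∀ t : ℝ, 0 ≤ t → F t ≤ G t) ∧
  ∀ M : ℝ → Ω → ℝ, RCPaths M → IsMartingale μ F M → IsMartingale μ G M

/-- The usual conditions: the filtration is right-continuous and `F 0` contains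
all `μ`-null sets. -/
def UsualConditions {m0 : MeasurableSpace Ω} (μ : Measure Ω)
    (F : ℝ → MeasurableSpace Ω) : Prop :=
  IsFiltration m0 F ∧ (∀ t : ℝ, 0 ≤ t → F t = rcReg F t) ∧
    ∀ s : Set Ω, μ s = 0 → MeasurableSet[F 0] s

/-- `E` is `Exp(1)`-distributed: `P(E > x) = e^{-x}` for all `x ≥ 0`. -/
def IsExpOne {m0 : MeasurableSpace Ω} (μ : Measure Ω) (E : Ω → ℝ) : Prop :=
  Measurable E ∧ ∀ x : ℝ, 0 ≤ x → μ {ω | x < E ω} = ENNReal.ofReal (Real.exp (-x))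

/-- `F_∞ = ⋁_{t ≥ 0} F t`. -/
def Finfty (F : ℝ → MeasurableSpace Ω) : MeasurableSpace Ω :=
  ⨆ t ∈ Set.Ici (0:ℝ), F t

/-- The natural filtration `(σ(Y_s : 0 ≤ s ≤ t))_{t ≥ 0}` of a process `Y`. -/
def natFilt {β : Type*} [MeasurableSpace β] (Y : ℝ → Ω → β) : ℝ → MeasurableSpace Ω :=
  fun t => ⨆ s ∈ Set.Icc (0:ℝ) t, MeasurableSpace.comap (Y s) inferInstance

/-- Progressive measurability of a process `u` with respect to the filtration `F`:
for every `t ≥ 0`, `(s, ω) ↦ u s ω` on `[0, t] × Ω` is `B([0,t]) ⊗ F t`-measurable. -/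
def ProgMeas (F : ℝ → MeasurableSpace Ω) (u : ℝ → Ω → ℝ) : Prop :=
  ∀ t : ℝ, 0 ≤ t →
    Measurable[MeasurableSpace.prod inferInstance (F t)]
      (fun p : Set.Icc (0:ℝ) t × Ω => u p.1 p.2)

/-- `X_t = #{k ≥ 1 : τ_k ≤ t}`. -/
def countX (τ : ℕ → Ω → ℝ) (t : ℝ) (ω : Ω) : ℕ :=
  Nat.card {k : ℕ // τ (k + 1) ω ≤ t}

/-- `X_{t-} = #{k ≥ 1 : τ_k < t}`. -/
def countXminus (τ : ℕ → Ω → ℝ) (t : ℝ) (ω : Ω) : ℕ :=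
  Nat.card {k : ℕ // τ (k + 1) ω < t}

lemma measurableSet_rcReg {F : ℝ → MeasurableSpace Ω} {t : ℝ} {A : Set Ω} :
    MeasurableSet[rcReg F t] A ↔ ∀ s, t < s → MeasurableSet[F s] A := by
  unfold rcReg
  rw [MeasurableSpace.measurableSet_iInf]
  refine forall_congr' fun s => ?_
  rw [MeasurableSpace.measurableSet_iInf]
  rfl

/-- Non-negative dyadic numbers. -/
def dyad : Set ℝ := {q | ∃ n i : ℕ, q = (i : ℝ) / 2 ^ n}

lemma dyad_countable : dyad.Countable := by
  have : dyad = Set.range (fun p : ℕ × ℕ => (p.2 : ℝ) / 2 ^ p.1) := by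
    ext q; simp [dyad, eq_comm]
  rw [this]; exact Set.countable_range _

/-- The dyadic of level `n` strictly following `t`. -/
def dnext (n : ℕ) (t : ℝ) : ℝ := ((⌊t * 2 ^ n⌋₊ + 1 : ℕ) : ℝ) / 2 ^ n

lemma dnext_mem (n : ℕ) (t : ℝ) : dnext n t ∈ dyad := ⟨n, _, rfl⟩

lemma lt_dnext (n : ℕ) (t : ℝ) : t < dnext n t := by
  rw [dnext, lt_div_iff₀ (by positivity)]
  push_cast
  exact Nat.lt_floor_add_one _

lemma dnext_le (n : ℕ) {t : ℝ} (ht : 0 ≤ t) : dnext n t ≤ t + (1 / 2) ^ n := by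
  rw [dnext, div_le_iff₀ (by positivity), add_mul, ← mul_pow]
  have := Nat.floor_le (show 0 ≤ t * 2 ^ n by positivity)
  push_cast
  norm_num
  exact this

lemma tendsto_dnext {t : ℝ} (ht : 0 ≤ t) : Tendsto (fun n => dnext n t) atTop (𝓝 t) := by
  refine tendsto_of_tendsto_of_tendsto_of_le_of_le tendsto_const_nhds
    (h := fun n : ℕ => t + (1 / 2 : ℝ) ^ n) ?_ (fun n => (lt_dnext n t).le) (fun n => dnext_le n ht)
  simpa using (tendsto_pow_atTop_nhds_zero_of_lt_one (r := (1 / 2 : ℝ)) (by norm_num)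
    (by norm_num)).const_add t

lemma tendsto_dnext' {t : ℝ} (ht : 0 ≤ t) :
    Tendsto (fun n => dnext n t) atTop (𝓝[Ioi t ∩ dyad] t) :=
  tendsto_nhdsWithin_iff.2 ⟨tendsto_dnext ht,
    Eventually.of_forall fun n => ⟨lt_dnext n t, dnext_mem n t⟩⟩

lemma dyad_neBot {t : ℝ} (ht : 0 ≤ t) : (𝓝[Ioi t ∩ dyad] t).NeBot :=
  (tendsto_dnext' ht).neBot

/-- Discrete filtration along the dyadic grid of level `n`. -/
def gridFilt {m0 : MeasurableSpace Ω} {H : ℝ → MeasurableSpace Ω} (hH : IsFiltration m0 H)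
    (n : ℕ) : Filtration ℕ m0 where
  seq i := H ((i : ℝ) / 2 ^ n)
  mono' := by
    intro i j hij
    exact hH.1 _ _ (by positivity) (by gcongr)
  le' := fun i => hH.2 _

/-- pathwise: oscillation on the right of `t` forces many upcrossings on fine grids -/
lemma many_upcrossings (g : ℝ → Ω → ℝ) (ω : Ω) (a b : ℝ) (hab : a < b) (t : ℝ) (ht : 0 ≤ t)
    (ha : ∃ᶠ q in 𝓝[Ioi t ∩ dyad] t, g q ω < a) (hb : ∃ᶠ q in 𝓝[Ioi t ∩ dyad] t, b < g q ω)
    (K : ℕ) : ∀ r : ℝ, t < r → ∃ n0 : ℕ, ∀ n ≥ n0, ∃ M : ℕ, (M : ℝ) ≤ r * 2 ^ n ∧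
      K ≤ upcrossingsBefore a b (fun i : ℕ => g ((i : ℝ) / 2 ^ n)) M ω := by
  induction K with
  | zero => intro r hr; exact ⟨0, fun n _ => ⟨0, by simp; nlinarith [pow_pos (two_pos : (0:ℝ) < 2) n], by simp⟩⟩
  | succ K ih =>
    intro r hr
    have pick : ∀ (p : ℝ → Prop), (∃ᶠ q in 𝓝[Ioi t ∩ dyad] t, p q) → ∀ r : ℝ, t < r →
        ∃ q, p q ∧ t < q ∧ q < r ∧ q ∈ dyad := by
      intro p hp r hr
      have h1 : ∀ᶠ q in 𝓝[Ioi t ∩ dyad] t, q < r :=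
        nhdsWithin_le_nhds (Iio_mem_nhds hr)
      have h2 : ∀ᶠ q in 𝓝[Ioi t ∩ dyad] t, q ∈ Ioi t ∩ dyad := self_mem_nhdsWithin
      obtain ⟨q, hq, hq1, hq2⟩ := (hp.and_eventually (h1.and h2)).exists
      exact ⟨q, hq, hq2.1, hq1, hq2.2⟩
    obtain ⟨q2, hq2, h2t, h2r, n2, i2, rfl⟩ := pick _ hb r hr
    obtain ⟨q1, hq1, h1t, h1r, n1, i1, rfl⟩ := pick _ ha _ h2t
    obtain ⟨n0, hn0⟩ := ih _ h1t
    obtain ⟨n3, hn3⟩ : ∃ n3 : ℕ, ∀ n ≥ n3, (1 / 2 : ℝ) ^ n < r - (i2 : ℝ) / 2 ^ n2 := by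
      have := (tendsto_pow_atTop_nhds_zero_of_lt_one (r := (1 / 2 : ℝ)) (by norm_num)
        (by norm_num)).eventually_lt_const (sub_pos.2 h2r)
      exact eventually_atTop.1 this
    refine ⟨max (max n0 n3) (max n1 n2), fun n hn => ?_⟩
    simp only [ge_iff_le, max_le_iff] at hn
    obtain ⟨⟨hn0', hn3'⟩, hn1, hn2⟩ := hn
    obtain ⟨M, hM, hMK⟩ := hn0 n hn0'
    have e : ∀ (i m : ℕ), m ≤ n → ((i * 2 ^ (n - m) : ℕ) : ℝ) / 2 ^ n = (i : ℝ) / 2 ^ m := by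
      intro i m hm
      have : (2 : ℝ) ^ n = 2 ^ (n - m) * 2 ^ m := by rw [← pow_add, Nat.sub_add_cancel hm]
      rw [this]; push_cast; field_simp
    have e' : ∀ (i m : ℕ), m ≤ n → ((i * 2 ^ (n - m) : ℕ) : ℝ) = (i : ℝ) / 2 ^ m * 2 ^ n := by
      intro i m hm
      rw [← e i m hm]; field_simp
    have key := upcrossingsBefore_lt_of_exists_upcrossing
      (f := fun i : ℕ => g ((i : ℝ) / 2 ^ n)) (ω := ω) hab (N := M) (N₁ := i1 * 2 ^ (n - n1))
      (N₂ := i2 * 2 ^ (n - n2)) ?_ ?_ ?_ ?_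
    · refine ⟨i2 * 2 ^ (n - n2) + 1, ?_, by omega⟩
      rw [Nat.cast_add, e' _ _ hn2]
      have h3 := hn3 n hn3'
      have : (1 / 2 : ℝ) ^ n * 2 ^ n = 1 := by rw [← mul_pow]; norm_num
      have p2 : (0:ℝ) < 2 ^ n := by positivity
      have := mul_lt_mul_of_pos_right h3 p2
      push_cast
      nlinarith
    · have : (M : ℝ) ≤ ((i1 * 2 ^ (n - n1) : ℕ) : ℝ) := by rw [e' _ _ hn1]; exact hM
      exact_mod_cast this
    · show g _ ω < a
      rw [e _ _ hn1]; exact hq1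
    · have : ((i1 * 2 ^ (n - n1) : ℕ) : ℝ) ≤ ((i2 * 2 ^ (n - n2) : ℕ) : ℝ) := by
        rw [e' _ _ hn1, e' _ _ hn2]; gcongr
      exact_mod_cast this
    · show b < g _ ω
      rw [e _ _ hn2]; exact hq2

lemma ae_no_osc {m0 : MeasurableSpace Ω} (μ : Measure Ω) [IsProbabilityMeasure μ]
    {H : ℝ → MeasurableSpace Ω} (hH : IsFiltration m0 H) (ξ : Ω → ℝ) 
    (a b : ℝ) (hab : a < b) (T : ℕ) :
    ∀ᵐ ω ∂μ, ∀ t : ℝ, 0 ≤ t → t < T →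
      ¬ ((∃ᶠ q in 𝓝[Ioi t ∩ dyad] t, (μ[ξ|H q]) ω < a) ∧
        ∃ᶠ q in 𝓝[Ioi t ∩ dyad] t, b < (μ[ξ|H q]) ω) := by
  set f : ℕ → ℕ → Ω → ℝ := fun n i => μ[ξ|H ((i : ℝ) / 2 ^ n)] with hf
  have hmart : ∀ n, Martingale (f n) (gridFilt hH n) μ := fun n =>
    martingale_condExp ξ (gridFilt hH n) μ
  set u : ℕ → Ω → ℝ≥0∞ := fun n ω => ((upcrossingsBefore a b (f n) (T * 2 ^ n) ω : ℕ) : ℝ≥0∞)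
    with hu
  have hmeas : ∀ n, Measurable (u n) := fun n =>
    measurable_from_top.comp ((hmart n).1.measurable_upcrossingsBefore hab)
  set C : ℝ := ((∫ ω, |ξ ω| ∂μ) + |a|) / (b - a) with hC
  have hbound : ∀ n, ∫⁻ ω, u n ω ∂μ ≤ ENNReal.ofReal C := by
    intro n
    have h1 := (hmart n).submartingale.mul_integral_upcrossingsBefore_le_integral_pos_part a b
      (T * 2 ^ n)
    have h2 : ∫ ω, (f n (T * 2 ^ n) ω - a)⁺ ∂μ ≤ (∫ ω, |ξ ω| ∂μ) + |a| := by
      calc ∫ ω, (f n (T * 2 ^ n) ω - a)⁺ ∂μ ≤ ∫ ω, (|f n (T * 2 ^ n) ω| + |a|) ∂μ := by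
            refine integral_mono_of_nonneg (Eventually.of_forall fun ω => posPart_nonneg _)
              ((integrable_condExp.abs).add (integrable_const _)) (Eventually.of_forall fun ω => ?_)
            show max _ _ ≤ _
            refine max_le ?_ (by positivity)
            have := le_abs_self (f n (T * 2 ^ n) ω)
            have := neg_abs_le a
            linarith
        _ = (∫ ω, |f n (T * 2 ^ n) ω| ∂μ) + |a| := by
            rw [integral_add integrable_condExp.abs (integrable_const _), integral_const]
            simp only [probReal_univ, one_smul]; rfl
        _ ≤ _ := by
            have := integral_abs_condExp_le (μ := μ) (m := H (((T * 2 ^ n : ℕ) : ℝ) / 2 ^ n)) ξ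
            exact add_le_add this le_rfl
    have h3 : ∫ ω, (upcrossingsBefore a b (f n) (T * 2 ^ n) ω : ℝ) ∂μ ≤ C := by
      rw [hC, le_div_iff₀ (sub_pos.2 hab), mul_comm]
      exact h1.trans h2
    rw [show (∫⁻ ω, u n ω ∂μ) = ∫⁻ ω, ENNReal.ofReal (upcrossingsBefore a b (f n) (T * 2 ^ n) ω : ℝ) ∂μ by simp [hu],
      ← ofReal_integral_eq_lintegral_ofReal ((hmart n).1.integrable_upcrossingsBefore hab)
        (Eventually.of_forall fun ω => by positivity)]
    exact ENNReal.ofReal_le_ofReal h3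
  have hfin : ∫⁻ ω, liminf (fun n => u n ω) atTop ∂μ ≠ ∞ := by
    refine ne_top_of_le_ne_top (ENNReal.ofReal_ne_top (r := C)) ?_
    refine (lintegral_liminf_le hmeas).trans ?_
    refine liminf_le_of_le (by isBoundedDefault) ?_
    intro c hc
    obtain ⟨n, hn⟩ := hc.exists
    exact hn.trans (hbound n)
  have hae := ae_lt_top (Measurable.liminf hmeas) hfin
  filter_upwards [hae] with ω hω t ht htT ⟨hA, hB⟩
  refine hω.ne (ENNReal.eq_top_of_forall_nnreal_le fun r => ?_)
  obtain ⟨K, hK⟩ := exists_nat_ge r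
  obtain ⟨n0, hn0⟩ := many_upcrossings (fun q => μ[ξ|H q]) ω a b hab t ht hA hB K T htT
  refine le_liminf_of_le (by isBoundedDefault) ?_
  filter_upwards [eventually_ge_atTop n0] with n hn
  obtain ⟨M, hM, hMK⟩ := hn0 n hn
  have hM' : M ≤ T * 2 ^ n := by exact_mod_cast hM
  have := hMK.trans (upcrossingsBefore_mono (f := f n) hab hM' ω)
  calc (r : ℝ≥0∞) ≤ (K : ℝ≥0∞) := by exact_mod_cast hK
    _ ≤ u n ω := by simp only [hu]; exact_mod_cast this

lemma exists_rc_modification {m0 : MeasurableSpace Ω} (μ : Measure Ω) [IsProbabilityMeasure μ]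
    {H : ℝ → MeasurableSpace Ω} (hUC : UsualConditions μ H) (ξ : Ω → ℝ) (hξ : Integrable ξ μ)
    (hξb : ∀ ω, |ξ ω| ≤ 1) :
    ∃ M : ℝ → Ω → ℝ, RCPaths M ∧ (∀ t, 0 ≤ t → Measurable[H t] (M t)) ∧
      ∀ t, 0 ≤ t → M t =ᵐ[μ] μ[ξ|H t] := by
  obtain ⟨hH, hrc, hnull⟩ := hUC
  set N : ℝ → Ω → ℝ := fun q => μ[ξ|H q] with hN
  have hb : ∀ᵐ ω ∂μ, ∀ q ∈ dyad, |N q ω| ≤ 1 := by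
    rw [ae_ball_iff dyad_countable]
    intro q _
    exact ae_bdd_abs_condExp_of_ae_bdd_abs (R := (1:ℝ)) (Eventually.of_forall hξb)
  have hosc : ∀ᵐ ω ∂μ, ∀ (a b : ℚ), (a : ℝ) < b → ∀ T : ℕ, ∀ t : ℝ, 0 ≤ t → t < T →
      ¬ ((∃ᶠ q in 𝓝[Ioi t ∩ dyad] t, N q ω < a) ∧
        ∃ᶠ q in 𝓝[Ioi t ∩ dyad] t, b < N q ω) := by
    simp only [ae_all_iff]
    intro a b hab T
    simpa only [ae_all_iff] using ae_no_osc μ hH ξ a b hab T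
  set good : Set Ω := {ω | (∀ q ∈ dyad, |N q ω| ≤ 1) ∧
    ∀ t : ℝ, 0 ≤ t → ∃ l, Tendsto (fun q => N q ω) (𝓝[Ioi t ∩ dyad] t) (𝓝 l)} with hgood
  have hgae : ∀ᵐ ω ∂μ, ω ∈ good := by
    filter_upwards [hb, hosc] with ω h1 h2
    refine ⟨h1, fun t ht => ?_⟩
    have hmem : ∀ᶠ q in 𝓝[Ioi t ∩ dyad] t, |N q ω| ≤ 1 := by
      filter_upwards [self_mem_nhdsWithin] with q hq using h1 q hq.2
    refine tendsto_of_no_upcrossings (Rat.denseRange_cast (𝕜 := ℝ)) ?_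
      ⟨1, eventually_map.2 (hmem.mono fun q hq => (abs_le.1 hq).2)⟩
      ⟨-1, eventually_map.2 (hmem.mono fun q hq => (abs_le.1 hq).1)⟩
    rintro _ ⟨a, rfl⟩ _ ⟨b, rfl⟩ hab
    obtain ⟨T, hT⟩ := exists_nat_gt t
    exact h2 a b hab T t ht hT
  have hgm : ∀ t, 0 ≤ t → MeasurableSet[H t] good := by
    intro t ht
    have : MeasurableSet[H 0] goodᶜ := hnull _ hgae
    exact hH.1 0 t le_rfl ht _ (by simpa using this.compl)
  classical
  set M : ℝ → Ω → ℝ := fun t ω => if h : ω ∈ good ∧ 0 ≤ t then (h.1.2 t h.2).choose else 0 with hM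
  have hMlim : ∀ ω ∈ good, ∀ t, 0 ≤ t →
      Tendsto (fun q => N q ω) (𝓝[Ioi t ∩ dyad] t) (𝓝 (M t ω)) := by
    intro ω hω t ht
    have : M t ω = (hω.2 t ht).choose := by simp only [hM]; rw [dif_pos ⟨hω, ht⟩]
    rw [this]; exact (hω.2 t ht).choose_spec
  have hMbad : ∀ ω, ω ∉ good → ∀ t, M t ω = 0 := by
    intro ω hω t
    simp only [hM]; rw [dif_neg (fun h => hω h.1)]
  have hMd : ∀ ω ∈ good, ∀ t, 0 ≤ t → Tendsto (fun n => N (dnext n t) ω) atTop (𝓝 (M t ω)) :=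
    fun ω hω t ht => (hMlim ω hω t ht).comp (tendsto_dnext' ht)
  have hMmeas : ∀ t, 0 ≤ t → Measurable[H t] (M t) := by
    intro t ht
    have key : ∀ s, t < s → Measurable[H s] (M t) := by
      intro s hs
      have hev : ∀ᶠ n in atTop, dnext n t < s := (tendsto_dnext ht).eventually_lt_const hs
      obtain ⟨n0, hn0⟩ := eventually_atTop.1 hev
      refine @measurable_of_tendsto_metrizable Ω ℝ (H s) _ _ _ _
        (fun n => good.indicator (N (dnext (n + n0) t))) _ ?_ ?_
      · intro n
        have hd : 0 ≤ dnext (n + n0) t := ht.trans (lt_dnext _ t).le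
        have : Measurable[H s] (N (dnext (n + n0) t)) :=
          (stronglyMeasurable_condExp.mono (hH.1 _ _ hd (hn0 _ (by omega)).le)).measurable
        exact this.indicator (hgm s (ht.trans hs.le))
      · rw [tendsto_pi_nhds]
        intro ω
        by_cases hω : ω ∈ good
        · simp only [Set.indicator_of_mem hω]
          exact (hMd ω hω t ht).comp (tendsto_add_atTop_nat n0)
        · simp only [Set.indicator_of_notMem hω, hMbad ω hω]
          exact tendsto_const_nhds
    intro S hS
    rw [hrc t ht]
    exact measurableSet_rcReg.2 fun s hs => key s hs hS
  refine ⟨M, ?_, ?_, ?_⟩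
  · intro ω t ht
    by_cases hω : ω ∈ good
    swap
    · have : (fun s => M s ω) = fun _ => 0 := by ext s; exact hMbad ω hω s
      rw [this]; exact continuousWithinAt_const
    rw [Metric.continuousWithinAt_iff]
    intro ε hε
    have h1 := (Metric.tendsto_nhds.1 (hMlim ω hω t ht)) (ε / 2) (by positivity)
    rw [eventually_nhdsWithin_iff, Metric.eventually_nhds_iff] at h1
    obtain ⟨δ, hδ, h1⟩ := h1
    refine ⟨δ, hδ, fun s hs hsd => ?_⟩
    rcases eq_or_lt_of_le (show t ≤ s from hs) with rfl | hlt
    · simpa using hε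
    have hs0 : 0 ≤ s := ht.trans hlt.le
    refine lt_of_le_of_lt ?_ (half_lt_self hε)
    have h2 := (hMd ω hω s hs0).dist (tendsto_const_nhds (x := M t ω))
    refine le_of_tendsto h2 ?_
    have h3 : ∀ᶠ n in atTop, dnext n s ∈ Metric.ball t δ :=
      (tendsto_dnext hs0).eventually (Metric.isOpen_ball.mem_nhds hsd)
    filter_upwards [h3] with n hn
    exact (h1 hn ⟨hlt.trans (lt_dnext n s), dnext_mem n s⟩).le
  · exact hMmeas
  · intro t ht
    have hmeas : ∀ n, AEStronglyMeasurable (N (dnext n t)) μ := fun n => 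
      integrable_condExp.aestronglyMeasurable
    have hlim : ∀ᵐ ω ∂μ, Tendsto (fun n => N (dnext n t) ω) atTop (𝓝 (M t ω)) := by
      filter_upwards [hgae] with ω hω using hMd ω hω t ht
    have hbd : ∀ n, ∀ᵐ ω ∂μ, ‖N (dnext n t) ω‖ ≤ (fun _ => (1:ℝ)) ω := by
      intro n
      filter_upwards [hb] with ω hω using hω _ (dnext_mem n t)
    have hMm : AEStronglyMeasurable (M t) μ := aestronglyMeasurable_of_tendsto_ae _ hmeas hlim
    have hMb : ∀ᵐ ω ∂μ, ‖M t ω‖ ≤ 1 := by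
      filter_upwards [hlim, hb] with ω h1 h2
      exact le_of_tendsto h1.norm (Eventually.of_forall fun n => h2 _ (dnext_mem n t))
    have hMi : Integrable (M t) μ := Integrable.of_bound hMm 1 hMb
    refine ae_eq_condExp_of_forall_setIntegral_eq (hH.2 t) hξ (fun s _ _ => hMi.integrableOn) ?_ ?_
    · intro s hs _
      have h1 : Tendsto (fun n => ∫ ω in s, N (dnext n t) ω ∂μ) atTop (𝓝 (∫ ω in s, M t ω ∂μ)) := by
        refine tendsto_integral_of_dominated_convergence (fun _ => (1:ℝ))
          (fun n => (hmeas n).restrict) (integrable_const _)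
          (fun n => ae_restrict_of_ae (hbd n)) (ae_restrict_of_ae hlim)
      have h2 : ∀ n, ∫ ω in s, N (dnext n t) ω ∂μ = ∫ ω in s, ξ ω ∂μ := by
        intro n
        exact setIntegral_condExp (hH.2 _) hξ (hH.1 _ _ ht (lt_dnext n t).le _ hs)
      simp only [h2] at h1
      exact (tendsto_nhds_unique h1 tendsto_const_nhds)
    · exact (hMmeas t ht).stronglyMeasurable.aestronglyMeasurable

lemma integral_mul_condExp_eq {m m0 : MeasurableSpace Ω} (μ : Measure Ω) [IsProbabilityMeasure μ]
    (hm : m ≤ m0) (f g : Ω → ℝ) (hf : Integrable f μ) (hg : Integrable g μ)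
    (hgb : ∀ ω, |g ω| ≤ 1) :
    ∫ ω, f ω * (μ[g|m]) ω ∂μ = ∫ ω, (μ[f|m]) ω * (μ[g|m]) ω ∂μ := by
  have hb : ∀ᵐ ω ∂μ, ‖(μ[g|m]) ω‖ ≤ 1 :=
    ae_bdd_abs_condExp_of_ae_bdd_abs (R := (1:ℝ)) (Eventually.of_forall hgb)
  have hi : Integrable (f * μ[g|m]) μ :=
    hf.mul_bdd (c := 1) integrable_condExp.aestronglyMeasurable hb
  have h := condExp_mul_of_stronglyMeasurable_right (μ := μ) (m := m) (f := f) (g := μ[g|m])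
    stronglyMeasurable_condExp hi hf
  calc ∫ ω, f ω * (μ[g|m]) ω ∂μ = ∫ ω, (μ[f * μ[g|m]|m]) ω ∂μ := (integral_condExp hm).symm
    _ = _ := integral_congr_ae h

lemma immersion_cond {m0 : MeasurableSpace Ω} (μ : Measure Ω) [IsProbabilityMeasure μ]
    {H K : ℝ → MeasurableSpace Ω} (hUC : UsualConditions μ H) (hK : ∀ t, 0 ≤ t → K t ≤ m0)
    (him : Immersed μ H K) {s t : ℝ} (ht : 0 ≤ t) (hts : t ≤ s) {A B : Set Ω}
    (hA : MeasurableSet[H s] A) (hB : MeasurableSet[K t] B) :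
    μ.real (A ∩ B) = ∫ ω in A, (μ[B.indicator (fun _ => (1:ℝ))|H t]) ω ∂μ := by
  have hH := hUC.1
  have hA0 : MeasurableSet[m0] A := hH.2 s _ hA
  have hB0 : MeasurableSet[m0] B := hK t ht _ hB
  set ξ : Ω → ℝ := A.indicator (fun _ => (1:ℝ)) with hξ
  set β : Ω → ℝ := B.indicator (fun _ => (1:ℝ)) with hβ
  have ib : ∀ (S : Set Ω) ω, |S.indicator (fun _ => (1:ℝ)) ω| ≤ 1 := by
    intro S ω; by_cases h : ω ∈ S <;> simp [h]
  have hξi : Integrable ξ μ := (integrable_const 1).indicator hA0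
  have hβi : Integrable β μ := (integrable_const 1).indicator hB0
  obtain ⟨M, hMrc, hMm, hMe⟩ := exists_rc_modification μ hUC ξ hξi (ib A)
  have hMH : IsMartingale μ H M := by
    refine ⟨fun t ht => (integrable_condExp.congr (hMe t ht).symm), hMm, fun s t hs hst => ?_⟩
    calc μ[M t|H s] =ᵐ[μ] μ[μ[ξ|H t]|H s] := condExp_congr_ae (hMe t (hs.trans hst))
      _ =ᵐ[μ] μ[ξ|H s] := condExp_condExp_of_le (hH.1 s t hs hst) (hH.2 t)
      _ =ᵐ[μ] M s := (hMe s hs).symm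
  have hMK := him.2 M hMrc hMH
  have hs0 : 0 ≤ s := ht.trans hts
  have hMs : M s =ᵐ[μ] ξ := by
    refine (hMe s hs0).trans ?_
    rw [condExp_of_stronglyMeasurable (hH.2 s) _ hξi]
    exact stronglyMeasurable_const.indicator hA
  have hkey : μ[ξ|K t] =ᵐ[μ] μ[ξ|H t] :=
    ((condExp_congr_ae hMs.symm).trans (hMK.2.2 t s ht hts)).trans (hMe t ht)
  have e1 : ∀ (S : Set Ω) (f : Ω → ℝ), MeasurableSet[m0] S →
      ∫ ω in S, f ω ∂μ = ∫ ω, S.indicator (fun _ => (1:ℝ)) ω * f ω ∂μ := by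
    intro S f hS
    rw [← integral_indicator hS]
    congr 1; ext ω; by_cases h : ω ∈ S <;> simp [h]
  calc μ.real (A ∩ B) = ∫ ω in B, ξ ω ∂μ := by
        rw [hξ, integral_indicator hA0, Measure.restrict_restrict hA0]; simp
    _ = ∫ ω in B, (μ[ξ|K t]) ω ∂μ := (setIntegral_condExp (hK t ht) hξi hB).symm
    _ = ∫ ω in B, (μ[ξ|H t]) ω ∂μ := integral_congr_ae (ae_restrict_of_ae hkey)
    _ = ∫ ω, β ω * (μ[ξ|H t]) ω ∂μ := e1 _ _ hB0
    _ = ∫ ω, (μ[β|H t]) ω * (μ[ξ|H t]) ω ∂μ :=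
        integral_mul_condExp_eq μ (hH.2 t) β ξ hβi hξi (ib A)
    _ = ∫ ω, ξ ω * (μ[β|H t]) ω ∂μ := by
        rw [integral_mul_condExp_eq μ (hH.2 t) ξ β hξi hβi (ib B)]
        simp only [mul_comm]
    _ = _ := (e1 _ _ hA0).symm

lemma const_of_quadratic (g : ℝ → ℝ) (T K : ℝ) (hT : 0 ≤ T)
    (h : ∀ s t, 0 ≤ s → s ≤ t → t ≤ T → |g t - g s| ≤ K * (t - s) ^ 2) : g T = g 0 := by
  have hn : ∀ n : ℕ, |g T - g 0| ≤ K * T ^ 2 / ((n : ℝ) + 1) := by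
    intro n
    have h1 : g T - g 0 = ∑ i ∈ Finset.range (n + 1),
        (g (((i + 1 : ℕ) : ℝ) * T / (n + 1)) - g ((i : ℝ) * T / (n + 1))) := by
      rw [Finset.sum_range_sub (fun i : ℕ => g ((i : ℝ) * T / (n + 1)))]
      have : ((n + 1 : ℕ) : ℝ) * T / (n + 1) = T := by push_cast; field_simp
      rw [this]; simp
    rw [h1]
    refine (Finset.abs_sum_le_sum_abs _ _).trans ?_
    calc _ ≤ ∑ i ∈ Finset.range (n + 1), K * (T / (n + 1)) ^ 2 := by
          refine Finset.sum_le_sum fun i hi => ?_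
          have hi' : ((i + 1 : ℕ) : ℝ) ≤ n + 1 := by
            have := Finset.mem_range.1 hi
            exact_mod_cast this
          refine (h _ _ (by positivity) ?_ ?_).trans (le_of_eq ?_)
          · gcongr; simp
          · rw [div_le_iff₀ (by positivity)]; nlinarith
          · push_cast; congr 2; field_simp; ring
      _ = _ := by simp; field_simp
  have hlim : Tendsto (fun n : ℕ => K * T ^ 2 / ((n : ℝ) + 1)) atTop (𝓝 0) :=
    by
      have := (tendsto_one_div_add_atTop_nhds_zero_nat (𝕜 := ℝ)).const_mul (K * T ^ 2)
      simpa [div_eq_mul_inv] using this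
  have := ge_of_tendsto' hlim hn
  exact sub_eq_zero.1 (abs_nonpos_iff.1 this)

lemma exp_of_integral_eq (Z c : ℝ → ℝ) (K : ℝ) (hZc : Continuous Z) (hZpos : ∀ t, 0 < Z t)
    (hZanti : ∀ s t, 0 ≤ s → s ≤ t → Z t ≤ Z s) (hc : Measurable c)
    (hc0 : ∀ t, 0 ≤ c t) (hcK : ∀ t, c t ≤ K)
    (heq : ∀ t, 0 ≤ t → Z t + ∫ u in Ioc 0 t, c u * Z u = 1) :
    ∀ t, 0 ≤ t → Z t = Real.exp (-∫ u in Ioc 0 t, c u) := by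
  have hK : 0 ≤ K := (hc0 0).trans (hcK 0)
  have hci : ∀ a b, IntegrableOn c (Ioc a b) := fun a b =>
    Measure.integrableOn_of_bounded (M := K) (by simp) hc.aestronglyMeasurable
      (Eventually.of_forall fun u => by rw [Real.norm_of_nonneg (hc0 u)]; exact hcK u)
  have hZle : ∀ t, 0 ≤ t → Z t ≤ Z 0 := fun t ht => hZanti 0 t le_rfl ht
  have hZ0 : Z 0 = 1 := by simpa using heq 0 le_rfl
  have hcZi : ∀ a b, 0 ≤ a → IntegrableOn (fun u => c u * Z u) (Ioc a b) := fun a b ha =>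
    Measure.integrableOn_of_bounded (M := K) (by simp)
      (hc.mul hZc.measurable).aestronglyMeasurable
      (by
        filter_upwards [ae_restrict_mem measurableSet_Ioc] with u hu
        rw [Real.norm_of_nonneg (mul_nonneg (hc0 u) (hZpos u).le)]
        have := hZle u (ha.trans hu.1.le)
        have := hc0 u
        have := hcK u
        have := hZpos u
        nlinarith)
  have hsplit : ∀ (f : ℝ → ℝ) s t, 0 ≤ s → s ≤ t → (∀ a b, 0 ≤ a → IntegrableOn f (Ioc a b)) →
      ∫ u in Ioc 0 t, f u = (∫ u in Ioc 0 s, f u) + ∫ u in Ioc s t, f u := by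
    intro f s t hs hst hf
    rw [← Ioc_union_Ioc_eq_Ioc hs hst, setIntegral_union (Ioc_disjoint_Ioc_of_le le_rfl)
      measurableSet_Ioc (hf _ _ le_rfl) (hf _ _ hs)]
  intro T hT
  have hg := const_of_quadratic (fun t => Real.log (Z t) + ∫ u in Ioc 0 t, c u) T (K ^ 2 / Z T) hT ?_
  · simp only [hZ0, Real.log_one, Ioc_self, Measure.restrict_empty, integral_zero_measure,
      add_zero] at hg
    rw [← Real.exp_log (hZpos T)]
    congr 1; linarith
  intro s t hs hst htT
  have ht : 0 ≤ t := hs.trans hst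
  set I := ∫ u in Ioc s t, c u with hI
  have hC := hsplit c s t hs hst (fun a b _ => hci a b)
  have hD := hsplit (fun u => c u * Z u) s t hs hst hcZi
  have hDeq : Z s - Z t = ∫ u in Ioc s t, c u * Z u := by
    have := heq s hs; have := heq t ht; linarith
  have hI0 : 0 ≤ I := setIntegral_nonneg measurableSet_Ioc fun u _ => hc0 u
  have hIK : I ≤ K * (t - s) := by
    calc I ≤ ∫ u in Ioc s t, K := by
          refine setIntegral_mono (hci _ _) (integrable_const _) (fun u => hcK u)
      _ = _ := by simp [hst, mul_comm]
  have h1 : Z t * I ≤ Z s - Z t := by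
    rw [hDeq, hI, ← integral_const_mul]
    refine setIntegral_mono_on ((hci _ _).const_mul _) (hcZi _ _ hs) measurableSet_Ioc fun u hu => ?_
    rw [mul_comm]
    exact mul_le_mul_of_nonneg_left (hZanti u t (hs.trans hu.1.le) hu.2) (hc0 u)
  have h2 : Z s - Z t ≤ Z s * I := by
    rw [hDeq, hI, ← integral_const_mul]
    refine setIntegral_mono_on (hcZi _ _ hs) ((hci _ _).const_mul _) measurableSet_Ioc fun u hu => ?_
    rw [mul_comm]
    exact mul_le_mul_of_nonneg_right (hZanti s u hs hu.1.le) (hc0 u)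
  have hZs := hZpos s
  have hZt := hZpos t
  have hZT := hZpos T
  have hZs1 : Z s ≤ 1 := hZ0 ▸ hZle s hs
  have hZtT : Z T ≤ Z t := hZanti t T ht htT
  have hl1 : Real.log (Z s) - Real.log (Z t) ≤ Z s / Z t - 1 := by
    rw [← Real.log_div hZs.ne' hZt.ne']
    exact Real.log_le_sub_one_of_pos (by positivity)
  have hl2 : Real.log (Z t) - Real.log (Z s) ≤ Z t / Z s - 1 := by
    rw [← Real.log_div hZt.ne' hZs.ne']
    exact Real.log_le_sub_one_of_pos (by positivity)
  have hr : Z s / Z t - 1 ≤ I / Z T := by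
    rw [div_sub_one hZt.ne', div_le_div_iff₀ hZt hZT]
    nlinarith [mul_nonneg hI0 hZt.le, mul_nonneg hI0 hZs.le]
  have hr1 : Z s / Z t - 1 ≤ (Z s / Z t) * I := by
    rw [div_sub_one hZt.ne', div_mul_eq_mul_div, div_le_div_iff_of_pos_right hZt]; exact h2
  have hr2 : Z t / Z s - 1 ≤ - (Z t / Z s) * I := by
    rw [div_sub_one hZs.ne', ← neg_div, div_mul_eq_mul_div, div_le_div_iff_of_pos_right hZs]
    linarith
  have hr3 : 1 - Z t / Z s ≤ Z s / Z t - 1 := by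
    have : 0 ≤ (Z s - Z t) ^ 2 / (Z s * Z t) := by positivity
    have e : (Z s - Z t) ^ 2 / (Z s * Z t) = Z s / Z t - 1 - (1 - Z t / Z s) := by
      field_simp
    linarith
  have hmain : I * (Z s / Z t - 1) ≤ K ^ 2 / Z T * (t - s) ^ 2 := by
    calc I * (Z s / Z t - 1) ≤ I * (I / Z T) := by gcongr
      _ = I ^ 2 / Z T := by ring
      _ ≤ (K * (t - s)) ^ 2 / Z T := by gcongr
      _ = _ := by ring
  show |Real.log (Z t) + (∫ u in Ioc 0 t, c u) - (Real.log (Z s) + ∫ u in Ioc 0 s, c u)| ≤ _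
  rw [hC, abs_le]
  constructor <;> nlinarith

lemma cont_mart_const {m0 : MeasurableSpace Ω} (μ : Measure Ω) [IsProbabilityMeasure μ]
    {H : ℝ → MeasurableSpace Ω} (hH : IsFiltration m0 H) (m : ℝ → Ω → ℝ) (T b V : ℝ) (hT : 0 ≤ T)
    (hm : ∀ t, 0 ≤ t → AEStronglyMeasurable[H t] (m t) μ)
    (hb : ∀ᵐ ω ∂μ, ∀ t, 0 ≤ t → t ≤ T → |m t ω| ≤ b)
    (hmart : ∀ s t, 0 ≤ s → s ≤ t → t ≤ T → μ[m t|H s] =ᵐ[μ] m s)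
    (hcont : ∀ᵐ ω ∂μ, ContinuousOn (fun t => m t ω) (Icc 0 T))
    (hV : ∀ᵐ ω ∂μ, ∀ n : ℕ, ∑ i ∈ Finset.range (n + 1),
      |m (((i + 1 : ℕ) : ℝ) * T / (n + 1)) ω - m ((i : ℝ) * T / (n + 1)) ω| ≤ V) :
    m T =ᵐ[μ] m 0 := by
  set p : ℕ → ℕ → ℝ := fun n i => (i : ℝ) * T / (n + 1) with hp
  have hp0 : ∀ n i, 0 ≤ p n i := fun n i => by simp only [hp]; positivity
  have hpT : ∀ n i, i ≤ n + 1 → p n i ≤ T := fun n i hi => by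
    simp only [hp]; rw [div_le_iff₀ (by positivity)]
    have : (i : ℝ) ≤ n + 1 := by exact_mod_cast hi
    nlinarith
  have hpmono : ∀ n i, p n i ≤ p n (i + 1) := fun n i => by
    simp only [hp]; gcongr; simp
  have hpl : ∀ n, p n (n + 1) = T := fun n => by simp only [hp]; push_cast; field_simp
  have hpz : ∀ n, p n 0 = 0 := fun n => by simp [hp]
  have hmm : ∀ t, 0 ≤ t → AEStronglyMeasurable (m t) μ := fun t ht => (hm t ht).mono (hH.2 t)
  have hbt : ∀ t, 0 ≤ t → t ≤ T → ∀ᵐ ω ∂μ, ‖m t ω‖ ≤ b := fun t h1 h2 => by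
    filter_upwards [hb] with ω hω using hω t h1 h2
  have hmInt : ∀ t, 0 ≤ t → t ≤ T → Integrable (m t) μ := fun t h1 h2 =>
    Integrable.of_bound (hmm t h1) b (hbt t h1 h2)
  -- bounded products
  have hsqi : ∀ s t s' t', 0 ≤ s → s ≤ T → 0 ≤ t → t ≤ T → 0 ≤ s' → s' ≤ T → 0 ≤ t' → t' ≤ T →
      Integrable (fun ω => (m s ω - m t ω) * (m s' ω - m t' ω)) μ := by
    intro s t s' t' h1 h2 h3 h4 h5 h6 h7 h8
    refine ((hmInt s' h5 h6).sub (hmInt t' h7 h8)).bdd_mul (c := b + b)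
      ((hmm s h1).sub (hmm t h3)) ?_
    filter_upwards [hbt s h1 h2, hbt t h3 h4] with ω a1 a2
    exact (norm_sub_le _ _).trans (add_le_add a1 a2)
  have horth : ∀ s t, 0 ≤ s → s ≤ t → t ≤ T →
      ∫ ω, (m s ω - m 0 ω) * (m t ω - m s ω) ∂μ = 0 := by
    intro s t hs hst htT
    have ht := hs.trans hst
    have hsT := hst.trans htT
    have hx : AEStronglyMeasurable[H s] (m s - m 0) μ :=
      (hm s hs).sub ((hm 0 le_rfl).mono (hH.1 0 s le_rfl hs))
    have hfg : Integrable ((m s - m 0) * (m t - m s)) μ :=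
      hsqi s 0 t s hs hsT le_rfl hT ht htT hs hsT
    have h1 := condExp_mul_of_aestronglyMeasurable_left hx hfg
      ((hmInt t ht htT).sub (hmInt s hs hsT))
    have h2 : μ[m t - m s|H s] =ᵐ[μ] 0 := by
      have ha := condExp_sub (hmInt t ht htT) (hmInt s hs hsT) (H s)
      have hb' := hmart s t hs hst htT
      have hc := hmart s s hs le_rfl hsT
      filter_upwards [ha, hb', hc] with ω e1 e2 e3
      rw [e1, Pi.sub_apply, e2, e3]; simp
    calc ∫ ω, (m s ω - m 0 ω) * (m t ω - m s ω) ∂μ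
        = ∫ ω, (μ[(m s - m 0) * (m t - m s)|H s]) ω ∂μ := (integral_condExp (hH.2 s)).symm
      _ = ∫ ω, 0 ∂μ := by
          refine integral_congr_ae ?_
          filter_upwards [h1, h2] with ω e1 e2
          rw [e1, Pi.mul_apply, e2]; simp
      _ = 0 := by simp
  have hsum : ∀ n j, j ≤ n + 1 → ∫ ω, (m (p n j) ω - m 0 ω) * (m (p n j) ω - m 0 ω) ∂μ =
      ∑ i ∈ Finset.range j, ∫ ω, (m (p n (i+1)) ω - m (p n i) ω) *
        (m (p n (i+1)) ω - m (p n i) ω) ∂μ := by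
    intro n j
    induction j with
    | zero => intro _; simp [hpz]
    | succ j ih =>
      intro hj
      have hj' : j ≤ n + 1 := by omega
      rw [Finset.sum_range_succ, ← ih hj']
      have a1 := hp0 n j
      have a2 := hpT n j hj'
      have a3 := hp0 n (j+1)
      have a4 := hpT n (j+1) hj
      have h3 := horth (p n j) (p n (j+1)) a1 (hpmono n j) a4
      rw [← integral_add (hsqi _ _ _ _ a1 a2 le_rfl hT a1 a2 le_rfl hT)
        (hsqi _ _ _ _ a3 a4 a1 a2 a3 a4 a1 a2)]
      have : ∀ x, x = x + 2 * ∫ ω, (m (p n j) ω - m 0 ω) * (m (p n (j+1)) ω - m (p n j) ω) ∂μ := by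
        intro x; rw [h3]; ring
      rw [this (∫ ω, (_ + _) ∂μ), ← integral_const_mul, ← integral_add]
      · congr 1; ext ω; ring
      · exact (hsqi _ _ _ _ a1 a2 le_rfl hT a1 a2 le_rfl hT).add
          (hsqi _ _ _ _ a3 a4 a1 a2 a3 a4 a1 a2)
      · exact (hsqi _ _ _ _ a1 a2 le_rfl hT a3 a4 a1 a2).const_mul 2
  have htot : ∀ n, ∫ ω, (m T ω - m 0 ω) * (m T ω - m 0 ω) ∂μ =
      ∫ ω, ∑ i ∈ Finset.range (n + 1), (m (p n (i+1)) ω - m (p n i) ω) *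
        (m (p n (i+1)) ω - m (p n i) ω) ∂μ := by
    intro n
    have := hsum n (n + 1) le_rfl
    rw [hpl] at this
    rw [this, integral_finsetSum]
    intro i hi
    have hi' := Finset.mem_range.1 hi
    exact hsqi _ _ _ _ (hp0 _ _) (hpT _ _ (by omega)) (hp0 _ _) (hpT _ _ (by omega))
      (hp0 _ _) (hpT _ _ (by omega)) (hp0 _ _) (hpT _ _ (by omega))
  have hlim : Tendsto (fun n => ∫ ω, ∑ i ∈ Finset.range (n + 1), (m (p n (i+1)) ω - m (p n i) ω) *
        (m (p n (i+1)) ω - m (p n i) ω) ∂μ) atTop (𝓝 (∫ ω, (0:ℝ) ∂μ)) := by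
    refine tendsto_integral_of_dominated_convergence (fun _ => 2 * b * V) ?_ (integrable_const _)
      ?_ ?_
    · intro n
      refine Finset.aestronglyMeasurable_fun_sum _ fun i _ => ?_
      exact ((hmm _ (hp0 _ _)).sub (hmm _ (hp0 _ _))).mul ((hmm _ (hp0 _ _)).sub (hmm _ (hp0 _ _)))
    · intro n
      filter_upwards [hb, hV] with ω h1 h2
      rw [Real.norm_of_nonneg (Finset.sum_nonneg fun i _ => mul_self_nonneg _)]
      have hb0 : 0 ≤ b := (abs_nonneg _).trans (h1 0 le_rfl hT)
      calc _ ≤ ∑ i ∈ Finset.range (n + 1), 2 * b * |m (p n (i+1)) ω - m (p n i) ω| := by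
            refine Finset.sum_le_sum fun i hi => ?_
            have hi' := Finset.mem_range.1 hi
            rw [← abs_mul_abs_self]
            refine mul_le_mul_of_nonneg_right ?_ (abs_nonneg _)
            have g1 := h1 _ (hp0 n (i+1)) (hpT _ _ (by omega))
            have g2 := h1 _ (hp0 n i) (hpT _ _ (by omega))
            have := abs_sub (m (p n (i+1)) ω) (m (p n i) ω)
            linarith
        _ = 2 * b * ∑ i ∈ Finset.range (n + 1), |m (p n (i+1)) ω - m (p n i) ω| := by
            rw [Finset.mul_sum]
        _ ≤ 2 * b * V := mul_le_mul_of_nonneg_left (h2 n) (by positivity)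
    · filter_upwards [hcont, hV] with ω h1 h2
      have hV0 : 0 ≤ V := (Finset.sum_nonneg fun i _ => abs_nonneg _).trans (h2 0)
      have huc := isCompact_Icc.uniformContinuousOn_of_continuous h1
      rw [Metric.uniformContinuousOn_iff] at huc
      rw [Metric.tendsto_atTop]
      intro ε hε
      obtain ⟨δ, hδ, hd⟩ := huc (ε / (V + 1)) (by positivity)
      obtain ⟨N, hN⟩ := exists_nat_gt (T / δ)
      refine ⟨N, fun n hn => ?_⟩
      rw [Real.dist_eq, sub_zero, abs_of_nonneg (Finset.sum_nonneg fun i _ => mul_self_nonneg _)]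
      calc _ ≤ ∑ i ∈ Finset.range (n + 1), ε / (V + 1) * |m (p n (i+1)) ω - m (p n i) ω| := by
            refine Finset.sum_le_sum fun i hi => ?_
            have hi' := Finset.mem_range.1 hi
            rw [← abs_mul_abs_self]
            refine mul_le_mul_of_nonneg_right ?_ (abs_nonneg _)
            have := hd (p n (i+1)) ⟨hp0 _ _, hpT _ _ (by omega)⟩ (p n i)
              ⟨hp0 _ _, hpT _ _ (by omega)⟩ ?_
            · rw [Real.dist_eq] at this; exact this.le
            · rw [Real.dist_eq, abs_of_nonneg (sub_nonneg.2 (hpmono n i))]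
              have : p n (i+1) - p n i = T / (n + 1) := by simp only [hp]; push_cast; field_simp; ring
              rw [this, div_lt_iff₀ (by positivity)]
              rw [div_lt_iff₀ hδ] at hN
              have : (N : ℝ) ≤ n := by exact_mod_cast hn
              nlinarith
        _ = ε / (V + 1) * ∑ i ∈ Finset.range (n + 1), |m (p n (i+1)) ω - m (p n i) ω| := by
            rw [Finset.mul_sum]
        _ ≤ ε / (V + 1) * V := mul_le_mul_of_nonneg_left (h2 n) (by positivity)
        _ < ε := by
            rw [div_mul_eq_mul_div, div_lt_iff₀ (by positivity)]; nlinarith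
  simp only [← htot, integral_zero] at hlim
  have hz := tendsto_nhds_unique hlim tendsto_const_nhds
  rw [eq_comm, integral_eq_zero_iff_of_nonneg (fun ω => mul_self_nonneg _)
    (hsqi _ _ _ _ hT le_rfl le_rfl hT hT le_rfl le_rfl hT)] at hz
  filter_upwards [hz] with ω hω
  have : (m T ω - m 0 ω) * (m T ω - m 0 ω) = 0 := hω
  exact sub_eq_zero.1 (mul_self_eq_zero.1 this)

/-- Progressive measurability in a form convenient for integration. -/
def ProgC (H : ℝ → MeasurableSpace Ω) (c : ℝ → Ω → ℝ) : Prop :=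
  ∀ t : ℝ, 0 ≤ t → Measurable[MeasurableSpace.prod inferInstance (H t)]
    (fun p : ℝ × Ω => c (min p.1 t) p.2)

lemma measurable_param_integral [MeasurableSpace Ω] {f : ℝ × Ω → ℝ} (hf : Measurable f)
    (S : Set ℝ) : Measurable (fun ω => ∫ u in S, f (u, ω)) :=
  (hf.stronglyMeasurable.integral_prod_left' (μ := volume.restrict S)).measurable

lemma measurable_of_cont_param [MeasurableSpace Ω] {u : ℝ → Ω → ℝ}
    (h1 : ∀ ω, Continuous fun t => u t ω) (h2 : ∀ t, Measurable (u t)) :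
    Measurable (fun p : ℝ × Ω => u p.1 p.2) :=
  measurable_uncurry_of_continuous_of_measurable (u := u) h1 h2

lemma measurable_mul_param [MeasurableSpace Ω] {a b : ℝ × Ω → ℝ}
    (h1 : Measurable a) (h2 : Measurable b) : Measurable (fun p : ℝ × Ω => a p * b p) :=
  h1.mul h2

lemma ProgC.measurable_integral {H : ℝ → MeasurableSpace Ω} {c : ℝ → Ω → ℝ} (hc : ProgC H c)
    {t : ℝ} (ht : 0 ≤ t) : Measurable[H t] (fun ω => ∫ u in Ioc 0 t, c u ω) := by
  have h := @measurable_param_integral Ω (H t) _ (hc t ht) (Ioc 0 t)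
  refine Eq.mp ?_ h
  congr 1
  ext ω
  refine setIntegral_congr_fun measurableSet_Ioc fun u hu => ?_
  simp only [min_eq_left hu.2]

lemma ProgC.measurable {m0 : MeasurableSpace Ω} {H : ℝ → MeasurableSpace Ω}
    (hH : IsFiltration m0 H) {c : ℝ → Ω → ℝ} (hc : ProgC H c) :
    Measurable (fun p : ℝ × Ω => c p.1 p.2) := by
  refine measurable_of_tendsto_metrizable (f := fun n : ℕ => fun p : ℝ × Ω => c (min p.1 n) p.2)
    ?_ ?_
  · intro n
    have h := hc n (by positivity)
    exact h.mono (sup_le_sup le_rfl (MeasurableSpace.comap_mono (hH.2 n))) le_rfl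
  · rw [tendsto_pi_nhds]
    intro p
    refine tendsto_const_nhds.congr' ?_
    obtain ⟨N, hN⟩ := exists_nat_ge p.1
    filter_upwards [eventually_ge_atTop N] with n hn
    rw [min_eq_left (hN.trans (by exact_mod_cast hn))]

lemma ProgC.measurable_at {H : ℝ → MeasurableSpace Ω} {c : ℝ → Ω → ℝ} (hc : ProgC H c)
    {t : ℝ} (ht : 0 ≤ t) : Measurable[H t] (c t) := by
  have h := hc t ht
  have h2 : Measurable[H t, MeasurableSpace.prod inferInstance (H t)] (fun ω : Ω => (t, ω)) :=
    @measurable_prodMk_left ℝ Ω _ (H t) t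
  have := h.comp h2
  simpa [Function.comp_def] using this

lemma exp_formula {m0 : MeasurableSpace Ω} (μ : Measure Ω) [IsProbabilityMeasure μ]
    {H : ℝ → MeasurableSpace Ω} (hH : IsFiltration m0 H) (T0 : Ω → ℝ) (hT0 : Measurable T0)
    (hT0pos : ∀ᵐ ω ∂μ, 0 < T0 ω)
    (Z : ℝ → Ω → ℝ) (hZc : ∀ ω, Continuous fun t => Z t ω) (hZpos : ∀ t ω, 0 < Z t ω)
    (hZm : ∀ t, Measurable[H (max t 0)] (Z t)) (hZi : ∀ t, 0 ≤ t → Integrable (Z t) μ)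
    (h1 : ∀ s t, 0 ≤ s → 0 ≤ t → ∀ A, MeasurableSet[H s] A →
      μ.real (A ∩ {ω | t < T0 ω}) = ∫ ω in A, Z t ω ∂μ)
    (c : ℝ → Ω → ℝ) (K : ℝ) (hc : ProgC H c) (hc0 : ∀ t ω, 0 ≤ c t ω) (hcK : ∀ t ω, c t ω ≤ K)
    (h2 : ∀ s t, 0 ≤ s → s ≤ t → ∀ B, MeasurableSet[H s] B →
      μ.real (B ∩ {ω | s < T0 ω ∧ T0 ω ≤ t}) =
        ∫ ω in B, (∫ u in Ioc s t, if u ≤ T0 ω then c u ω else 0) ∂μ) :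
    ∀ᵐ ω ∂μ, ∀ t, 0 ≤ t → Z t ω = Real.exp (-∫ u in Ioc 0 t, c u ω) := by
  have hK : 0 ≤ K := by
    have : Nonempty Ω := (inferInstance : NeZero μ).out |> fun h => by
      by_contra hne
      rw [not_nonempty_iff] at hne
      exact h (Measure.eq_zero_of_isEmpty μ)
    exact (hc0 0 (Classical.arbitrary Ω)).trans (hcK 0 _)
  have hcm : Measurable (fun p : ℝ × Ω => c p.1 p.2) := hc.measurable hH
  have hZm0 : ∀ t, Measurable (Z t) := fun t => (hZm t).mono (hH.2 _) le_rfl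
  have hZj : Measurable (fun p : ℝ × Ω => Z p.1 p.2) := by
    exact measurable_uncurry_of_continuous_of_measurable (u := Z) hZc hZm0
  have hZm1 : ∀ t, 0 ≤ t → Measurable[H t] (Z t) := fun t ht => by
    have h := hZm t
    rwa [max_eq_left ht] at h
  have hTm : ∀ s, MeasurableSet {ω | s < T0 ω} := fun s => measurableSet_lt measurable_const hT0
  have hZc1 : ∀ s t, 0 ≤ s → s ≤ t →
      Z s =ᵐ[μ] μ[{ω | s < T0 ω}.indicator (fun _ => (1:ℝ))|H t] := by
    intro s t hs hst
    refine ae_eq_condExp_of_forall_setIntegral_eq (hH.2 t)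
      ((integrable_const 1).indicator (hTm s)) (fun A _ _ => (hZi s hs).integrableOn) ?_ ?_
    · intro A hA _
      rw [← h1 t s (hs.trans hst) hs A hA, integral_indicator (hTm s),
        Measure.restrict_restrict (hTm s), inter_comm]
      simp
    · have : Measurable[H s] (Z s) := hZm1 s hs
      exact (this.mono (hH.1 s t hs hst) le_rfl).stronglyMeasurable.aestronglyMeasurable
  -- antitone
  have hZmono : ∀ s t, 0 ≤ s → s ≤ t → Z t ≤ᵐ[μ] Z s := by
    intro s t hs hst
    have e1 := hZc1 s t hs hst
    have e2 := hZc1 t t (hs.trans hst) le_rfl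
    have e3 : μ[{ω | t < T0 ω}.indicator (fun _ => (1:ℝ))|H t] ≤ᵐ[μ]
        μ[{ω | s < T0 ω}.indicator (fun _ => (1:ℝ))|H t] := by
      refine condExp_mono ((integrable_const 1).indicator (hTm t))
        ((integrable_const 1).indicator (hTm s)) (Eventually.of_forall fun ω => ?_)
      refine indicator_le_indicator_of_subset (fun ω hω => ?_) (fun _ => zero_le_one) ω
      exact lt_of_le_of_lt hst hω
    filter_upwards [e1, e2, e3] with ω a1 a2 a3
    rw [a1, a2]; exact a3
  have hZ0 : Z 0 =ᵐ[μ] fun _ => 1 := by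
    refine (hZc1 0 0 le_rfl le_rfl).trans ?_
    have : {ω | 0 < T0 ω}.indicator (fun _ => (1:ℝ)) =ᵐ[μ] fun _ => 1 := by
      filter_upwards [hT0pos] with ω hω
      simp [hω]
    refine (condExp_congr_ae this).trans ?_
    rw [condExp_const (hH.2 0)]
  have hanti : ∀ᵐ ω ∂μ, ∀ s t, 0 ≤ s → s ≤ t → Z t ω ≤ Z s ω := by
    have : ∀ᵐ ω ∂μ, ∀ s ∈ dyad, ∀ t ∈ dyad, s ≤ t → Z t ω ≤ Z s ω := by
      rw [ae_ball_iff dyad_countable]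
      intro s hs
      rw [ae_ball_iff dyad_countable]
      intro t ht
      by_cases hst : s ≤ t
      · have hs0 : 0 ≤ s := by obtain ⟨n, i, rfl⟩ := hs; positivity
        filter_upwards [hZmono s t hs0 hst] with ω h _ using h
      · exact Eventually.of_forall fun ω h => absurd h hst
    filter_upwards [this] with ω hω s t hs hst
    have ht := hs.trans hst
    refine le_of_tendsto_of_tendsto' (((hZc ω).tendsto t).comp (tendsto_dnext ht))
      (((hZc ω).tendsto s).comp (tendsto_dnext hs)) fun n => ?_
    refine hω _ (dnext_mem n s) _ (dnext_mem n t) ?_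
    unfold dnext
    refine div_le_div_of_nonneg_right ?_ (by positivity)
    have : ⌊s * 2 ^ n⌋₊ ≤ ⌊t * 2 ^ n⌋₊ := Nat.floor_mono (by gcongr)
    have : (⌊s * 2 ^ n⌋₊ : ℝ) ≤ ⌊t * 2 ^ n⌋₊ := by exact_mod_cast this
    push_cast
    linarith
  have hcmω : ∀ ω, Measurable fun u => c u ω := fun ω => hcm.comp measurable_prodMk_right
  have hII : ∀ ω a b, IntervalIntegrable (fun u => c u ω * Z u ω) volume a b := by
    intro ω a b
    refine IntervalIntegrable.mul_continuousOn ?_ (hZc ω).continuousOn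
    refine (intervalIntegrable_const (c := K)).mono_fun (hcmω ω).aestronglyMeasurable
      (Eventually.of_forall fun u => ?_)
    show ‖c u ω‖ ≤ ‖K‖
    rw [Real.norm_of_nonneg (hc0 u ω), Real.norm_of_nonneg hK]; exact hcK u ω
  have hIntOn : ∀ ω a b, IntegrableOn (fun u => c u ω * Z u ω) (Ioc a b) volume := fun ω a b => by
    rcases le_total a b with h | h
    · exact (intervalIntegrable_iff_integrableOn_Ioc_of_le h).1 (hII ω a b)
    · simp [Ioc_eq_empty (not_lt.2 h)]
  set I : ℝ → Ω → ℝ := fun t ω => ∫ u in Ioc 0 t, c u ω * Z u ω with hI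
  have hIcont : ∀ ω, ContinuousOn (fun t => I t ω) (Ici 0) := by
    intro ω
    have := intervalIntegral.continuous_primitive (hII ω) 0
    refine this.continuousOn.congr fun t ht => ?_
    simp only [hI]; rw [intervalIntegral.integral_of_le ht]
  have hIm : ∀ t, 0 ≤ t → Measurable[H t] (I t) := by
    intro t ht
    have g1 : Measurable[MeasurableSpace.prod inferInstance (H t)]
        (fun p : ℝ × Ω => Z (min p.1 t) p.2) := by
      refine @measurable_of_cont_param Ω (H t) (fun u ω => Z (min u t) ω) ?_ ?_
      · exact fun ω => (hZc ω).comp (continuous_id.min continuous_const)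
      · intro u
        exact (hZm (min u t)).mono (hH.1 _ _ (le_max_right _ _)
          (max_le (min_le_right _ _) ht)) le_rfl
    have g2 : Measurable[MeasurableSpace.prod inferInstance (H t)]
        (fun p : ℝ × Ω => c (min p.1 t) p.2 * Z (min p.1 t) p.2) :=
      @measurable_mul_param Ω (H t) _ _ (hc t ht) g1
    have h := @measurable_param_integral Ω (H t) _ g2 (Ioc 0 t)
    refine Eq.mp ?_ h
    congr 1
    ext ω
    refine setIntegral_congr_fun measurableSet_Ioc fun u hu => ?_
    simp only [min_eq_left hu.2]
  have hIsub : ∀ ω s t, 0 ≤ s → s ≤ t → I t ω - I s ω = ∫ u in Ioc s t, c u ω * Z u ω := by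
    intro ω s t hs hst
    simp only [hI]
    rw [← Ioc_union_Ioc_eq_Ioc hs hst, setIntegral_union (Ioc_disjoint_Ioc_of_le le_rfl)
      measurableSet_Ioc (hIntOn _ _ _) (hIntOn _ _ _)]
    ring
  have hIbd : ∀ᵐ ω ∂μ, ∀ s t, 0 ≤ s → s ≤ t → 0 ≤ I t ω - I s ω ∧ I t ω - I s ω ≤ K * (t - s) := by
    filter_upwards [hanti, hZ0] with ω ha h0 s t hs hst
    rw [hIsub ω s t hs hst]
    refine ⟨setIntegral_nonneg measurableSet_Ioc fun u _ => mul_nonneg (hc0 _ _) (hZpos _ _).le, ?_⟩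
    calc _ ≤ ∫ u in Ioc s t, K := by
          refine setIntegral_mono_on (hIntOn _ _ _) (integrable_const _) measurableSet_Ioc
            fun u hu => ?_
          have e1 := ha 0 u le_rfl (hs.trans hu.1.le)
          rw [h0] at e1
          have e2 := hcK u ω
          have e3 := hc0 u ω
          have e4 := (hZpos u ω).le
          nlinarith
      _ = _ := by simp [hst, mul_comm]
  set m : ℝ → Ω → ℝ := fun t ω => Z t ω + I t ω with hm
  have hI0 : ∀ ω, I 0 ω = 0 := fun ω => by simp [hI]
  have hIi : ∀ t, 0 ≤ t → Integrable (I t) μ := by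
    intro t ht
    refine Integrable.of_bound ((hIm t ht).mono (hH.2 t) le_rfl).aestronglyMeasurable (K * t) ?_
    filter_upwards [hIbd] with ω hω
    have := hω 0 t le_rfl ht
    rw [hI0, sub_zero, sub_zero] at this
    rw [Real.norm_of_nonneg this.1]; exact this.2
  -- the martingale property
  have hmart : ∀ s t, 0 ≤ s → s ≤ t → μ[m t|H s] =ᵐ[μ] m s := by
    intro s t hs hst
    have ht := hs.trans hst
    symm
    have hmi : ∀ t, 0 ≤ t → Integrable (m t) μ := fun t ht => (hZi t ht).add (hIi t ht)
    refine ae_eq_condExp_of_forall_setIntegral_eq (hH.2 s) (hmi t ht)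
      (fun A _ _ => (hmi s hs).integrableOn) ?_ ?_
    · intro B hB _
      simp only [hm]
      rw [integral_add (hZi s hs).integrableOn (hIi s hs).integrableOn,
        integral_add (hZi t ht).integrableOn (hIi t ht).integrableOn,
        ← h1 s s hs hs B hB, ← h1 s t hs ht B hB]
      have hB0 := hH.2 s _ hB
      have e1 : μ.real (B ∩ {ω | s < T0 ω}) =
          μ.real (B ∩ {ω | t < T0 ω}) + μ.real (B ∩ {ω | s < T0 ω ∧ T0 ω ≤ t}) := by
        rw [← measureReal_union]
        · congr 1; ext ω
          simp only [mem_inter_iff, mem_ofPred_eq, mem_union]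
          constructor
          · rintro ⟨a, b⟩
            rcases lt_or_ge t (T0 ω) with h | h
            · exact Or.inl ⟨a, h⟩
            · exact Or.inr ⟨a, b, h⟩
          · rintro (⟨a, b⟩ | ⟨a, b, _⟩)
            · exact ⟨a, hst.trans_lt b⟩
            · exact ⟨a, b⟩
        · rw [Set.disjoint_left]
          rintro ω ⟨_, h⟩ ⟨_, _, h'⟩
          exact absurd h (not_lt.2 h')
        · exact hB0.inter ((hTm s).inter (measurableSet_le hT0 measurable_const))
      have e2 : ∫ ω in B, I t ω ∂μ - ∫ ω in B, I s ω ∂μ =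
          ∫ ω in B, (∫ u in Ioc s t, c u ω * Z u ω) ∂μ := by
        rw [← integral_sub (hIi t ht).integrableOn (hIi s hs).integrableOn]
        congr 1; ext ω; exact hIsub ω s t hs hst
      rw [e1, h2 s t hs hst B hB]
      suffices hsuff : ∫ ω in B, (∫ u in Ioc s t, if u ≤ T0 ω then c u ω else 0) ∂μ =
          ∫ ω in B, (∫ u in Ioc s t, c u ω * Z u ω) ∂μ by
        rw [hsuff, ← e2]; ring
      have e3 : ∀ ω, (∫ u in Ioc s t, if u ≤ T0 ω then c u ω else 0) =
          ∫ u in Ioc s t, c u ω * {ω | u < T0 ω}.indicator (fun _ => (1:ℝ)) ω := by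
        intro ω
        refine integral_congr_ae (ae_restrict_of_ae ?_)
        have : ∀ᵐ u : ℝ, u ≠ T0 ω := by
          simp [ae_iff]
        filter_upwards [this] with u hu
        by_cases h : u < T0 ω
        · simp [h, h.le]
        · have h3 : ¬ u ≤ T0 ω := fun h4 => h (lt_of_le_of_ne h4 hu)
          simp [h, h3]
      simp only [e3]
      have hj1 : Measurable (fun p : Ω × ℝ => c p.2 p.1 *
          {ω | p.2 < T0 ω}.indicator (fun _ => (1:ℝ)) p.1) := by
        have : Measurable ({p : Ω × ℝ | p.2 < T0 p.1}.indicator (fun _ => (1:ℝ))) :=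
          measurable_const.indicator (measurableSet_lt measurable_snd (hT0.comp measurable_fst))
        exact (hcm.comp measurable_swap).mul this
      have hj2 : Measurable (fun p : Ω × ℝ => c p.2 p.1 * Z p.2 p.1) :=
        (hcm.comp measurable_swap).mul (hZj.comp measurable_swap)
      have ij2 : Integrable (fun p : Ω × ℝ => c p.2 p.1 * Z p.2 p.1)
          ((μ.restrict B).prod (volume.restrict (Ioc s t))) := by
        refine Integrable.of_bound hj2.aestronglyMeasurable K ?_
        rw [Measure.ae_prod_iff_ae_ae (measurableSet_le hj2.norm measurable_const)]
        refine ae_restrict_of_ae ?_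
        filter_upwards [hanti, hZ0] with ω ha h0
        refine (ae_restrict_iff' measurableSet_Ioc).2 (Eventually.of_forall fun u hu => ?_)
        have a1 := ha 0 u le_rfl (hs.trans hu.1.le)
        rw [h0] at a1
        have a2 := hcK u ω
        have a3 := hc0 u ω
        have a4 := (hZpos u ω).le
        rw [Real.norm_of_nonneg (mul_nonneg a3 a4)]
        nlinarith
      have ij1 : Integrable (fun p : Ω × ℝ => c p.2 p.1 *
          {ω | p.2 < T0 ω}.indicator (fun _ => (1:ℝ)) p.1)
          ((μ.restrict B).prod (volume.restrict (Ioc s t))) := by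
        refine Integrable.of_bound hj1.aestronglyMeasurable K (Eventually.of_forall fun p => ?_)
        have e1 := hc0 p.2 p.1
        have e2 := hcK p.2 p.1
        by_cases h : p.2 < T0 p.1
        · simp only [mem_ofPred_eq, h, indicator_of_mem, mul_one]
          rw [Real.norm_of_nonneg e1]; exact e2
        · simpa [h] using hK
      have sw1 := integral_integral_swap (f := fun ω u => c u ω *
          {ω | u < T0 ω}.indicator (fun _ => (1:ℝ)) ω) (μ := μ.restrict B)
          (ν := volume.restrict (Ioc s t)) ij1
      have sw2 := integral_integral_swap (f := fun ω u => c u ω * Z u ω) (μ := μ.restrict B)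
          (ν := volume.restrict (Ioc s t)) ij2
      rw [sw1, sw2]
      refine setIntegral_congr_fun measurableSet_Ioc fun u hu => ?_
      have hu0 : 0 ≤ u := hs.trans hu.1.le
      have hBu : MeasurableSet[H u] B := hH.1 s u hs hu.1.le _ hB
      -- pull-out
      set x : Ω → ℝ := B.indicator (c u) with hx
      have hxm : StronglyMeasurable[H u] x :=
        ((hc.measurable_at hu0).indicator hBu).stronglyMeasurable
      have hxb : ∀ᵐ ω ∂μ, ‖x ω‖ ≤ K := Eventually.of_forall fun ω => by
        by_cases h : ω ∈ B
        · simp only [hx, indicator_of_mem h]; rw [Real.norm_of_nonneg (hc0 _ _)]; exact hcK _ _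
        · simpa [hx, h] using hK
      have hβi : Integrable ({ω | u < T0 ω}.indicator (fun _ => (1:ℝ))) μ :=
        (integrable_const 1).indicator (hTm u)
      have hxβ : Integrable (x * {ω | u < T0 ω}.indicator (fun _ => (1:ℝ))) μ :=
        hβi.bdd_mul (hxm.mono (hH.2 u)).aestronglyMeasurable hxb
      have hpo := condExp_mul_of_stronglyMeasurable_left hxm hxβ hβi
      show ∫ ω in B, _ ∂μ = ∫ ω in B, _ ∂μ
      rw [← integral_indicator hB0, ← integral_indicator hB0]
      calc ∫ ω, B.indicator (fun ω => c u ω * {ω | u < T0 ω}.indicator (fun _ => (1:ℝ)) ω) ω ∂μ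
          = ∫ ω, (x * {ω | u < T0 ω}.indicator (fun _ => (1:ℝ))) ω ∂μ := by
            congr 1; ext ω; by_cases h : ω ∈ B <;> simp [hx, h]
        _ = ∫ ω, (μ[x * {ω | u < T0 ω}.indicator (fun _ => (1:ℝ))|H u]) ω ∂μ :=
            (integral_condExp (hH.2 u)).symm
        _ = ∫ ω, B.indicator (fun ω => c u ω * Z u ω) ω ∂μ := by
            refine integral_congr_ae ?_
            filter_upwards [hpo, hZc1 u u hu0 le_rfl] with ω a1 a2
            rw [a1, Pi.mul_apply, ← a2]
            by_cases h : ω ∈ B <;> simp [hx, h]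
    · have : Measurable[H s] (Z s) := hZm1 s hs
      exact (this.add (hIm s hs)).stronglyMeasurable.aestronglyMeasurable
  have hconst : ∀ T, 0 ≤ T → m T =ᵐ[μ] m 0 := by
    intro T hT
    refine cont_mart_const μ hH m T (1 + K * T) (1 + K * T) hT ?_ ?_
      (fun s t hs hst _ => hmart s t hs hst) ?_ ?_
    · intro t ht
      have : Measurable[H t] (Z t) := hZm1 t ht
      exact (this.add (hIm t ht)).stronglyMeasurable.aestronglyMeasurable
    · filter_upwards [hanti, hIbd, hZ0] with ω ha hb h0 t ht htT
      have g1 := ha 0 t le_rfl ht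
      have g2 := hb 0 t le_rfl ht
      rw [hI0] at g2
      rw [h0] at g1
      have g3 := hZpos t ω
      simp only [hm]
      rw [abs_of_nonneg (by linarith [g2.1])]
      nlinarith [g2.2]
    · exact Eventually.of_forall fun ω =>
        (hZc ω).continuousOn.add ((hIcont ω).mono fun t ht => ht.1)
    · filter_upwards [hanti, hIbd, hZ0] with ω ha hb h0 n
      set p : ℕ → ℝ := fun i => (i : ℝ) * T / (n + 1) with hp
      have hp0 : ∀ i, 0 ≤ p i := fun i => by simp only [hp]; positivity
      have hpmono : ∀ i, p i ≤ p (i + 1) := fun i => by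
        simp only [hp]; gcongr; simp
      calc ∑ i ∈ Finset.range (n + 1), |m (p (i+1)) ω - m (p i) ω|
          ≤ ∑ i ∈ Finset.range (n + 1), ((K * p (i+1) - Z (p (i+1)) ω) - (K * p i - Z (p i) ω)) := by
            refine Finset.sum_le_sum fun i _ => ?_
            have g1 := ha _ _ (hp0 i) (hpmono i)
            have g2 := hb _ _ (hp0 i) (hpmono i)
            simp only [hm]
            rw [abs_le]; constructor <;> nlinarith [g2.1, g2.2, mul_nonneg hK (sub_nonneg.2 (hpmono i))]
        _ = (K * p (n+1) - Z (p (n+1)) ω) - (K * p 0 - Z (p 0) ω) :=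
            Finset.sum_range_sub (fun i => K * p i - Z (p i) ω) _
        _ ≤ 1 + K * T := by
            have e1 : p (n+1) = T := by simp only [hp]; push_cast; field_simp
            have e2 : p 0 = 0 := by simp [hp]
            rw [e1, e2, h0]
            have := hZpos T ω
            linarith
  have hall : ∀ᵐ ω ∂μ, ∀ t, 0 ≤ t → m t ω = 1 := by
    have : ∀ᵐ ω ∂μ, ∀ t ∈ dyad, m t ω = m 0 ω := by
      rw [ae_ball_iff dyad_countable]
      intro t ht
      exact hconst t (by obtain ⟨n, i, rfl⟩ := ht; positivity)
    filter_upwards [this, hZ0] with ω hω h0 t ht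
    have hmc : ContinuousOn (fun t => m t ω) (Ici 0) := (hZc ω).continuousOn.add (hIcont ω)
    have h3 : Tendsto (fun n => m (dnext n t) ω) atTop (𝓝 (m t ω)) :=
      (hmc t ht).tendsto.comp (tendsto_nhdsWithin_iff.2 ⟨tendsto_dnext ht,
        Eventually.of_forall fun n => ht.trans (lt_dnext n t).le⟩)
    have h4 : ∀ n, m (dnext n t) ω = 1 := fun n => by
      rw [hω _ (dnext_mem n t)]; simp only [hm, hI0, h0, add_zero]
    simp only [h4] at h3
    exact tendsto_nhds_unique h3 tendsto_const_nhds
  filter_upwards [hall, hanti] with ω h3 h4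
  exact exp_of_integral_eq (fun t => Z t ω) (fun t => c t ω) K (hZc ω) (fun t => hZpos t ω) h4
    (hcmω ω) (fun t => hc0 t ω) (fun t => hcK t ω) h3

lemma lam_props (f : ℝ → ℝ) (K : ℝ) (hfm : Measurable f) (hf0 : ∀ t, 0 ≤ f t)
    (hfK : ∀ t, f t ≤ K) (s t : ℝ) (hs : 0 ≤ s) (hst : s ≤ t) :
    (∫ u in Ioc 0 s, f u) ≤ (∫ u in Ioc 0 t, f u) ∧
    (∫ u in Ioc 0 t, f u) ≤ (∫ u in Ioc 0 s, f u) + K * (t - s) := by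
  have hi : ∀ a b, IntegrableOn f (Ioc a b) volume := fun a b =>
    Integrable.of_bound hfm.aestronglyMeasurable K (Eventually.of_forall fun u => by
      rw [Real.norm_of_nonneg (hf0 u)]; exact hfK u)
  have e : (∫ u in Ioc 0 t, f u) = (∫ u in Ioc 0 s, f u) + ∫ u in Ioc s t, f u := by
    rw [← Ioc_union_Ioc_eq_Ioc hs hst, setIntegral_union (Ioc_disjoint_Ioc_of_le le_rfl)
      measurableSet_Ioc (hi _ _) (hi _ _)]
  have e0 : 0 ≤ ∫ u in Ioc s t, f u := setIntegral_nonneg measurableSet_Ioc fun u _ => hf0 u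
  have e1 : ∫ u in Ioc s t, f u ≤ K * (t - s) := by
    calc _ ≤ ∫ u in Ioc s t, K :=
          setIntegral_mono_on (hi _ _) (integrable_const _) measurableSet_Ioc fun u _ => hfK u
      _ = _ := by simp [hst, mul_comm]
  constructor <;> linarith

lemma exp_indep_grid {m0 : MeasurableSpace Ω} (μ : Measure Ω) [IsProbabilityMeasure μ]
    {H : ℝ → MeasurableSpace Ω} (hH : IsFiltration m0 H) (T0 : Ω → ℝ) (hT0 : Measurable T0)
    (hT0pos : ∀ᵐ ω ∂μ, 0 < T0 ω)
    (c : ℝ → Ω → ℝ) (K : ℝ) (hK : 0 < K) (hc : ProgC H c) (hc0 : ∀ t ω, 0 ≤ c t ω)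
    (hcK : ∀ t ω, c t ω ≤ K)
    (h1 : ∀ s t, 0 ≤ s → 0 ≤ t → ∀ A, MeasurableSet[H s] A →
      μ.real (A ∩ {ω | t < T0 ω}) = ∫ ω in A, Real.exp (-∫ u in Ioc 0 t, c u ω) ∂μ)
    (hinf : ∀ᵐ ω ∂μ, Tendsto (fun t : ℝ => ∫ u in Ioc 0 t, c u ω) atTop atTop)
    (s0 : ℝ) (hs0 : 0 ≤ s0) (A : Set Ω) (hA : MeasurableSet[H s0] A) (x δ : ℝ) (hx : 0 ≤ x)
    (hδ : 0 < δ) :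
    ENNReal.ofReal (Real.exp (-(x + K * δ))) * μ A ≤
        μ (A ∩ {ω | x < ∫ u in Ioc 0 (T0 ω), c u ω}) ∧
      μ (A ∩ {ω | x + K * δ < ∫ u in Ioc 0 (T0 ω), c u ω}) ≤
        ENNReal.ofReal (Real.exp (-x)) * μ A := by
  set Λ : ℝ → Ω → ℝ := fun t ω => ∫ u in Ioc 0 t, c u ω with hΛ
  have hcm : Measurable (fun p : ℝ × Ω => c p.1 p.2) := hc.measurable hH
  have hcmω : ∀ ω, Measurable fun u => c u ω := fun ω => hcm.comp measurable_prodMk_right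
  have hΛp : ∀ ω s t, 0 ≤ s → s ≤ t → Λ s ω ≤ Λ t ω ∧ Λ t ω ≤ Λ s ω + K * (t - s) :=
    fun ω s t hs hst => lam_props _ K (hcmω ω) (fun t => hc0 t ω) (fun t => hcK t ω) s t hs hst
  have hΛm : ∀ t, 0 ≤ t → Measurable[H t] (Λ t) := fun t ht => hc.measurable_integral ht
  have hΛ0 : ∀ ω, Λ 0 ω = 0 := fun ω => by simp [hΛ]
  set p : ℕ → ℝ := fun j => j * δ with hp
  have hp0 : ∀ j, 0 ≤ p j := fun j => by simp only [hp]; positivity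
  have hpm : Monotone p := fun i j hij => by
    simp only [hp]; gcongr
  have hps : ∀ j, p (j+1) - p j = δ := fun j => by simp only [hp]; push_cast; ring
  set D : ℕ → Set Ω := fun j => {ω | Λ (p j) ω ≤ x ∧ x < Λ (p (j+1)) ω} with hD
  have hDm : ∀ j, MeasurableSet[H (p (j+1))] (D j) := fun j => by
    have a1 : Measurable[H (p (j+1))] (Λ (p j)) :=
      (hΛm _ (hp0 j)).mono (hH.1 _ _ (hp0 j) (hpm (Nat.le_succ j))) le_rfl
    have b1 : MeasurableSet[H (p (j+1))] {ω | Λ (p j) ω ≤ x} := a1 measurableSet_Iic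
    have b2 : MeasurableSet[H (p (j+1))] {ω | x < Λ (p (j+1)) ω} :=
      (hΛm _ (hp0 (j+1))) measurableSet_Ioi
    exact MeasurableSet.inter b1 b2
  have hDm0 : ∀ j, MeasurableSet (D j) := fun j => hH.2 _ _ (hDm j)
  have hA0 := hH.2 _ _ hA
  have hTm : ∀ s, MeasurableSet {ω | s < T0 ω} := fun s => measurableSet_lt measurable_const hT0
  have hDdis : Pairwise (Function.onFun Disjoint D) := by
    intro i j hij
    wlog h : i < j generalizing i j
    · exact (this hij.symm (lt_of_le_of_ne (not_lt.1 h) hij.symm)).symm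
    rw [Function.onFun, Set.disjoint_left]
    rintro ω ⟨_, h2⟩ ⟨h3, _⟩
    have := (hΛp ω _ _ (hp0 (i+1)) (hpm (Nat.succ_le_of_lt h))).1
    linarith
  have hDall : ∀ᵐ ω ∂μ, ∃ j, ω ∈ D j := by
    filter_upwards [hinf] with ω hω
    have h3 : Tendsto p atTop atTop := tendsto_natCast_atTop_atTop.atTop_mul_const hδ
    have h4 : ∃ j, x < Λ (p j) ω := ((hω.comp h3).eventually_gt_atTop x).exists
    classical
    have h5 := Nat.find_spec h4
    have h6 : Nat.find h4 ≠ 0 := fun h => by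
      rw [h] at h5
      have e : p 0 = 0 := by simp [hp]
      rw [e, hΛ0] at h5
      linarith
    obtain ⟨i, hi⟩ := Nat.exists_eq_succ_of_ne_zero h6
    refine ⟨i, not_lt.1 (Nat.find_min h4 (by omega)), ?_⟩
    rw [hi] at h5; exact h5
  set B : ℕ → Set Ω := fun j => A ∩ D j ∩ {ω | p (j+1) < T0 ω} with hB
  have hBm : ∀ j, MeasurableSet (B j) := fun j => (hA0.inter (hDm0 j)).inter (hTm _)
  have hBdis : Pairwise (Function.onFun Disjoint B) := fun i j hij =>
    (hDdis hij).mono (fun ω h => h.1.2) (fun ω h => h.1.2)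
  have hsumA : ∑' j, μ (A ∩ D j) = μ A := by
    rw [← measure_iUnion (fun i j hij => (hDdis hij).mono inter_subset_right inter_subset_right)
      (fun j => hA0.inter (hDm0 j))]
    refine measure_congr ?_
    filter_upwards [hDall] with ω ⟨j, hj⟩
    refine eq_iff_iff.2 ?_
    show ω ∈ (⋃ j, A ∩ D j) ↔ ω ∈ A
    simp only [mem_iUnion, mem_inter_iff]
    constructor
    · rintro ⟨_, h, _⟩
      exact h
    · intro h
      exact ⟨j, h, hj⟩
  have hBj : ∀ j, μ (B j) = ∫⁻ ω in A ∩ D j, ENNReal.ofReal (Real.exp (-Λ (p (j+1)) ω)) ∂μ := by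
    intro j
    have hmx : MeasurableSet[H (max s0 (p (j+1)))] (A ∩ D j) :=
      MeasurableSet.inter (hH.1 _ _ hs0 (le_max_left _ _) _ hA)
        (hH.1 _ _ (hp0 _) (le_max_right _ _) _ (hDm j))
    have := h1 _ (p (j+1)) (hs0.trans (le_max_left _ _)) (hp0 _) _ hmx
    rw [← ofReal_integral_eq_lintegral_ofReal, ← this, ofReal_measureReal]
    · refine Integrable.of_bound ?_ 1 (Eventually.of_forall fun ω => ?_)
      · exact (Real.measurable_exp.comp ((hΛm _ (hp0 _)).mono (hH.2 _) le_rfl).neg).aestronglyMeasurable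
      · rw [Real.norm_of_nonneg (Real.exp_pos _).le, Real.exp_le_one_iff]
        have := (hΛp ω 0 _ le_rfl (hp0 (j+1))).1
        rw [hΛ0] at this; linarith
    · exact Eventually.of_forall fun ω => (Real.exp_pos _).le
  have hlo : ∀ j, ENNReal.ofReal (Real.exp (-(x + K * δ))) * μ (A ∩ D j) ≤ μ (B j) := by
    intro j
    rw [hBj, ← setLIntegral_const]
    refine setLIntegral_mono' (hA0.inter (hDm0 j)) fun ω hω => ?_
    refine ENNReal.ofReal_le_ofReal (Real.exp_le_exp.2 ?_)
    have := (hΛp ω _ _ (hp0 j) (hpm (Nat.le_succ j))).2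
    have h3 := hω.2.1
    rw [Nat.succ_eq_add_one, hps] at this
    linarith
  have hhi : ∀ j, μ (B j) ≤ ENNReal.ofReal (Real.exp (-x)) * μ (A ∩ D j) := by
    intro j
    rw [hBj, ← setLIntegral_const]
    refine setLIntegral_mono' (hA0.inter (hDm0 j)) fun ω hω => ?_
    refine ENNReal.ofReal_le_ofReal (Real.exp_le_exp.2 ?_)
    have h3 := hω.2.2
    linarith
  constructor
  · calc _ = ∑' j, ENNReal.ofReal (Real.exp (-(x + K * δ))) * μ (A ∩ D j) := by
          rw [ENNReal.tsum_mul_left, hsumA]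
      _ ≤ ∑' j, μ (B j) := ENNReal.tsum_le_tsum hlo
      _ = μ (⋃ j, B j) := (measure_iUnion hBdis hBm).symm
      _ ≤ _ := by
          refine measure_mono (iUnion_subset fun j ω hω => ⟨hω.1.1, ?_⟩)
          exact lt_of_lt_of_le hω.1.2.2 (hΛp ω _ _ (hp0 (j+1)) (le_of_lt hω.2)).1
  · calc _ ≤ μ (⋃ j, B j) := by
          refine measure_mono_ae ?_
          filter_upwards [hDall, hT0pos] with ω ⟨j, hj⟩ hpos hω
          refine mem_iUnion.2 ⟨j, ⟨⟨hω.1, hj⟩, ?_⟩⟩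
          show p (j+1) < T0 ω
          by_contra hcon
          have g1 := (hΛp ω _ _ hpos.le (not_lt.1 hcon)).1
          have g2 := (hΛp ω _ _ (hp0 j) (hpm (Nat.le_succ j))).2
          have g3 := hj.1
          have g4 : x + K * δ < Λ (T0 ω) ω := hω.2
          rw [Nat.succ_eq_add_one, hps] at g2
          linarith
      _ = ∑' j, μ (B j) := measure_iUnion hBdis hBm
      _ ≤ ∑' j, ENNReal.ofReal (Real.exp (-x)) * μ (A ∩ D j) := ENNReal.tsum_le_tsum hhi
      _ = _ := by rw [ENNReal.tsum_mul_left, hsumA]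

lemma exp_indep {m0 : MeasurableSpace Ω} (μ : Measure Ω) [IsProbabilityMeasure μ]
    {H : ℝ → MeasurableSpace Ω} (hH : IsFiltration m0 H) (T0 : Ω → ℝ) (hT0 : Measurable T0)
    (hT0pos : ∀ᵐ ω ∂μ, 0 < T0 ω)
    (c : ℝ → Ω → ℝ) (K : ℝ) (hK : 0 < K) (hc : ProgC H c) (hc0 : ∀ t ω, 0 ≤ c t ω)
    (hcK : ∀ t ω, c t ω ≤ K)
    (h1 : ∀ s t, 0 ≤ s → 0 ≤ t → ∀ A, MeasurableSet[H s] A →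
      μ.real (A ∩ {ω | t < T0 ω}) = ∫ ω in A, Real.exp (-∫ u in Ioc 0 t, c u ω) ∂μ)
    (hinf : ∀ᵐ ω ∂μ, Tendsto (fun t : ℝ => ∫ u in Ioc 0 t, c u ω) atTop atTop)
    (s0 : ℝ) (hs0 : 0 ≤ s0) (A : Set Ω) (hA : MeasurableSet[H s0] A) (x : ℝ) (hx : 0 ≤ x) :
    μ (A ∩ {ω | x < ∫ u in Ioc 0 (T0 ω), c u ω}) = μ A * ENNReal.ofReal (Real.exp (-x)) := by
  have key := exp_indep_grid μ hH T0 hT0 hT0pos c K hK hc hc0 hcK h1 hinf s0 hs0 A hA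
  rw [mul_comm]
  have hlim : ∀ y : ℝ, Tendsto (fun δ : ℝ => ENNReal.ofReal (Real.exp (-(x + y * δ))) * μ A)
      (𝓝[>] 0) (𝓝 (ENNReal.ofReal (Real.exp (-x)) * μ A)) := by
    intro y
    refine ENNReal.Tendsto.mul_const (ENNReal.tendsto_ofReal ?_) (Or.inr (measure_ne_top _ _))
    have : Continuous fun δ : ℝ => Real.exp (-(x + y * δ)) := by fun_prop
    have h := this.tendsto 0
    simp only [mul_zero, add_zero] at h
    exact h.mono_left nhdsWithin_le_nhds
  apply le_antisymm
  · rcases hx.eq_or_lt with rfl | hx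
    · simpa using measure_mono (μ := μ) (inter_subset_left (s := A))
    · refine ge_of_tendsto (hlim (-K)) ?_
      have : ∀ᶠ δ : ℝ in 𝓝[>] 0, δ < x / K :=
        (eventually_lt_nhds (by positivity)).filter_mono nhdsWithin_le_nhds
      filter_upwards [this, self_mem_nhdsWithin] with δ h1 h2
      rw [lt_div_iff₀ hK] at h1
      have h3 := (key (x - K * δ) δ (by nlinarith) h2).2
      have e1 : x - K * δ + K * δ = x := by ring
      have e2 : x - K * δ = x + -K * δ := by ring
      rw [e1, e2] at h3
      exact h3
  · refine le_of_tendsto (hlim K) ?_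
    filter_upwards [self_mem_nhdsWithin] with δ h2
    exact (key x δ hx h2).1

/-- All sample paths of jump times are well behaved. -/
def GoodT (τ : ℕ → Ω → ℝ) : Prop :=
  ∀ ω, τ 0 ω = 0 ∧ StrictMono (fun k => τ k ω) ∧ Tendsto (fun k => τ k ω) atTop atTop

lemma countX_eq {τ : ℕ → Ω → ℝ} {ω : Ω} (hm : StrictMono (fun k => τ k ω)) {t : ℝ} {k : ℕ}
    (h1 : τ k ω ≤ t) (h2 : t < τ (k+1) ω) : countX τ t ω = k := by
  have : {j : ℕ | τ (j+1) ω ≤ t} = Iio k := by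
    ext j
    simp only [mem_ofPred_eq, mem_Iio]
    constructor
    · intro h
      have := hm.lt_iff_lt.1 (h.trans_lt h2)
      omega
    · intro h
      exact (hm.monotone (show j + 1 ≤ k from h)).trans h1
  show Nat.card {j : ℕ | τ (j+1) ω ≤ t} = k
  rw [this]; simp

lemma countXminus_eq {τ : ℕ → Ω → ℝ} {ω : Ω} (hm : StrictMono (fun k => τ k ω)) {t : ℝ} {k : ℕ}
    (h1 : τ k ω < t) (h2 : t ≤ τ (k+1) ω) : countXminus τ t ω = k := by
  have : {j : ℕ | τ (j+1) ω < t} = Iio k := by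
    ext j
    simp only [mem_ofPred_eq, mem_Iio]
    constructor
    · intro h
      have := hm.lt_iff_lt.1 (h.trans_le h2)
      omega
    · intro h
      exact (hm.monotone (show j + 1 ≤ k from h)).trans_lt h1
  show Nat.card {j : ℕ | τ (j+1) ω < t} = k
  rw [this]; simp

lemma exists_idx {τ : ℕ → Ω → ℝ} (hτ : GoodT τ) (ω : Ω) {t : ℝ} (ht : 0 ≤ t) :
    ∃ k, τ k ω ≤ t ∧ t < τ (k+1) ω := by
  classical
  have h : ∃ k, t < τ k ω := ((hτ ω).2.2.eventually_gt_atTop t).exists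
  have h5 := Nat.find_spec h
  have h6 : Nat.find h ≠ 0 := fun h0 => by
    rw [h0, (hτ ω).1] at h5; linarith
  obtain ⟨i, hi⟩ := Nat.exists_eq_succ_of_ne_zero h6
  refine ⟨i, not_lt.1 (Nat.find_min h (by omega)), ?_⟩
  rw [hi] at h5; exact h5

lemma exists_idx' {τ : ℕ → Ω → ℝ} (hτ : GoodT τ) (ω : Ω) {t : ℝ} (ht : 0 < t) :
    ∃ k, τ k ω < t ∧ t ≤ τ (k+1) ω := by
  classical
  have h : ∃ k, t ≤ τ k ω := ((hτ ω).2.2.eventually_ge_atTop t).exists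
  have h5 := Nat.find_spec h
  have h6 : Nat.find h ≠ 0 := fun h0 => by
    rw [h0, (hτ ω).1] at h5; linarith
  obtain ⟨i, hi⟩ := Nat.exists_eq_succ_of_ne_zero h6
  refine ⟨i, not_le.1 (Nat.find_min h (by omega)), ?_⟩
  rw [hi] at h5; exact h5

lemma countX_iff {τ : ℕ → Ω → ℝ} (hτ : GoodT τ) (ω : Ω) {t : ℝ} (ht : 0 ≤ t) (k : ℕ) :
    countX τ t ω = k ↔ τ k ω ≤ t ∧ t < τ (k+1) ω := by
  constructor
  · rintro rfl
    obtain ⟨j, h1, h2⟩ := exists_idx hτ ω ht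
    rw [countX_eq (hτ ω).2.1 h1 h2]; exact ⟨h1, h2⟩
  · rintro ⟨h1, h2⟩; exact countX_eq (hτ ω).2.1 h1 h2

lemma countXminus_iff {τ : ℕ → Ω → ℝ} (hτ : GoodT τ) (ω : Ω) {t : ℝ} (ht : 0 < t) (k : ℕ) :
    countXminus τ t ω = k ↔ τ k ω < t ∧ t ≤ τ (k+1) ω := by
  constructor
  · rintro rfl
    obtain ⟨j, h1, h2⟩ := exists_idx' hτ ω ht
    rw [countXminus_eq (hτ ω).2.1 h1 h2]; exact ⟨h1, h2⟩
  · rintro ⟨h1, h2⟩; exact countXminus_eq (hτ ω).2.1 h1 h2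

lemma countXminus_nonpos {τ : ℕ → Ω → ℝ} (hτ : GoodT τ) (ω : Ω) {t : ℝ} (ht : t ≤ 0) :
    countXminus τ t ω = 0 := by
  have : IsEmpty {k : ℕ // τ (k+1) ω < t} := by
    refine ⟨fun ⟨k, hk⟩ => ?_⟩
    have := (hτ ω).2.1 (Nat.succ_pos k)
    have h0 := (hτ ω).1
    simp only [Nat.succ_eq_add_one] at this
    linarith
  simp [countXminus]

lemma countX_mono {τ : ℕ → Ω → ℝ} (hτ : GoodT τ) (ω : Ω) {s t : ℝ} (hs : 0 ≤ s) (hst : s ≤ t) :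
    countX τ s ω ≤ countX τ t ω := by
  obtain ⟨i, h1, h2⟩ := exists_idx hτ ω hs
  obtain ⟨j, h3, h4⟩ := exists_idx hτ ω (hs.trans hst)
  rw [countX_eq (hτ ω).2.1 h1 h2, countX_eq (hτ ω).2.1 h3 h4]
  have := (hτ ω).2.1.lt_iff_lt.1 ((h1.trans hst).trans_lt h4)
  omega

lemma measurable_countXminus_joint [MeasurableSpace Ω] {τ : ℕ → Ω → ℝ} (hτ : GoodT τ)
    (hm : ∀ k, Measurable (τ k)) : Measurable (fun p : ℝ × Ω => countXminus τ p.1 p.2) := by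
  refine measurable_to_countable' fun k => ?_
  have : (fun p : ℝ × Ω => countXminus τ p.1 p.2) ⁻¹' {k} =
      ({p | 0 < p.1} ∩ ({p | τ k p.2 < p.1} ∩ {p | p.1 ≤ τ (k+1) p.2})) ∪
      ({p | p.1 ≤ 0} ∩ {p | k = 0}) := by
    ext p
    simp only [mem_preimage, mem_singleton_iff, mem_union, mem_inter_iff, mem_ofPred_eq]
    rcases lt_or_ge 0 p.1 with h | h
    · rw [countXminus_iff hτ _ h]; simp [h, not_le.2 h]
    · rw [countXminus_nonpos hτ _ h]; simp [h, not_lt.2 h, eq_comm]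
  rw [this]
  refine MeasurableSet.union ((measurableSet_lt measurable_const measurable_fst).inter
    ((measurableSet_lt ((hm k).comp measurable_snd) measurable_fst).inter
      (measurableSet_le measurable_fst ((hm (k+1)).comp measurable_snd))))
    ((measurableSet_le measurable_fst measurable_const).inter (MeasurableSet.const _))

lemma measurable_comp_idx [MeasurableSpace Ω] {N : ℝ × Ω → ℕ} (hN : Measurable N)
    {c : ℕ → ℝ → Ω → ℝ} (hc : ∀ k, Measurable (fun p : ℝ × Ω => c k p.1 p.2)) :
    Measurable (fun p : ℝ × Ω => c (N p) p.1 p.2) :=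
  (measurable_from_prod_countable_right (f := fun q : ℕ × (ℝ × Ω) => c q.1 q.2.1 q.2.2) hc).comp
    (hN.prodMk measurable_id)

/-- Equidistant grid of `[s, t]` with `n + 1` pieces. -/
def grd (s t : ℝ) (n i : ℕ) : ℝ := s + i * ((t - s) / (n + 1))

lemma grd_zero (s t : ℝ) (n : ℕ) : grd s t n 0 = s := by simp [grd]

lemma grd_last (s t : ℝ) (n : ℕ) : grd s t n (n + 1) = t := by
  simp only [grd]; push_cast; field_simp; ring

lemma grd_succ (s t : ℝ) (n i : ℕ) : grd s t n (i + 1) = grd s t n i + (t - s) / (n + 1) := by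
  simp only [grd]; push_cast; ring

lemma grd_mono {s t : ℝ} (hst : s ≤ t) (n : ℕ) : Monotone (grd s t n) := by
  intro i j hij
  have : 0 ≤ (t - s) / ((n : ℝ) + 1) := div_nonneg (sub_nonneg.2 hst) (by positivity)
  simp only [grd]; gcongr

lemma grd_ge {s t : ℝ} (hst : s ≤ t) (n i : ℕ) : s ≤ grd s t n i := by
  have := grd_mono hst n (Nat.zero_le i); rwa [grd_zero] at this

lemma grd_le {s t : ℝ} (hst : s ≤ t) {n i : ℕ} (hi : i ≤ n + 1) : grd s t n i ≤ t := by
  have := grd_mono hst n hi; rwa [grd_last] at this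

lemma grd_exists {s t u : ℝ} (n : ℕ) (h1 : s < u) (h2 : u ≤ t) :
    ∃ i < n + 1, grd s t n i < u ∧ u ≤ grd s t n (i + 1) := by
  classical
  have h : ∃ j, u ≤ grd s t n j := ⟨n + 1, by rw [grd_last]; exact h2⟩
  have h5 := Nat.find_spec h
  have h6 : Nat.find h ≠ 0 := fun h0 => by
    rw [h0, grd_zero] at h5; linarith
  have h7 : Nat.find h ≤ n + 1 := Nat.find_min' h (by rw [grd_last]; exact h2)
  obtain ⟨i, hi⟩ := Nat.exists_eq_succ_of_ne_zero h6
  refine ⟨i, by omega, not_le.1 (Nat.find_min h (by omega)), ?_⟩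
  rw [hi] at h5; exact h5

lemma grd_unique {s t u : ℝ} (hst : s ≤ t) {n i j : ℕ} (h1 : grd s t n i < u)
    (h2 : u ≤ grd s t n (j + 1)) : i ≤ j := by
  by_contra h
  have := grd_mono hst n (show j + 1 ≤ i by omega)
  linarith

lemma mesh_small (s t ε : ℝ) (hε : 0 < ε) : ∀ᶠ n : ℕ in atTop, (t - s) / ((n : ℝ) + 1) < ε := by
  have : Tendsto (fun n : ℕ => (t - s) / ((n : ℝ) + 1)) atTop (𝓝 0) :=
    tendsto_const_nhds.div_atTop (tendsto_atTop_add_const_right _ _ tendsto_natCast_atTop_atTop)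
  exact this.eventually_lt_const hε

lemma jump_formula {m0 : MeasurableSpace Ω} (μ : Measure Ω) [IsProbabilityMeasure μ]
    {Gi : ℝ → MeasurableSpace Ω} (hGm : ∀ s t, 0 ≤ s → s ≤ t → Gi s ≤ Gi t)
    (hGi : ∀ t, 0 ≤ t → Gi t ≤ m0) (τ : ℕ → Ω → ℝ) (hτ : GoodT τ) (hτm : ∀ k, Measurable (τ k))
    (hτG : ∀ k t, 0 ≤ t → MeasurableSet[Gi t] {ω | τ k ω ≤ t})
    (c : ℕ → ℝ → Ω → ℝ) (K : ℝ) (hcm : ∀ k, Measurable (fun p : ℝ × Ω => c k p.1 p.2))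
    (hc0 : ∀ k t ω, 0 ≤ c k t ω) (hcK : ∀ k t ω, c k t ω ≤ K)
    (hXi : ∀ t, 0 ≤ t → Integrable (fun ω => (countX τ t ω : ℝ)) μ)
    (hX : ∀ s t, 0 ≤ s → s ≤ t → ∀ B, MeasurableSet[Gi s] B →
      ∫ ω in B, ((countX τ t ω : ℝ) - countX τ s ω) ∂μ =
        ∫ ω in B, (∫ u in Ioc s t, c (countXminus τ u ω) u ω) ∂μ)
    (k : ℕ) (s t : ℝ) (hs : 0 ≤ s) (hst : s ≤ t) (B : Set Ω) (hB : MeasurableSet[Gi s] B) :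
    μ.real (B ∩ {ω | s < τ (k+1) ω ∧ τ (k+1) ω ≤ t}) =
      ∫ ω in B, (∫ u in Ioc s t,
        if u ≤ τ (k+1) ω then (if τ k ω < u then c k u ω else 0) else 0) ∂μ := by
  rcases hst.eq_or_lt with rfl | hlt
  · have : {ω | s < τ (k+1) ω ∧ τ (k+1) ω ≤ s} = ∅ := by
      ext ω; simp
    simp [this]
  have hB0 := hGi s hs _ hB
  have ht : 0 ≤ t := hs.trans hst
  have hp0 : ∀ n i, 0 ≤ grd s t n i := fun n i => hs.trans (grd_ge hst n i)
  have hps : ∀ n i, grd s t n i ≤ grd s t n (i+1) := fun n i => grd_mono hst n (Nat.le_succ i)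
  set cc : ℝ → Ω → ℝ := fun u ω => c (countXminus τ u ω) u ω with hcc
  have hccm : Measurable (fun p : ℝ × Ω => cc p.1 p.2) :=
    measurable_comp_idx (measurable_countXminus_joint hτ hτm) hcm
  have hccω : ∀ ω, Measurable fun u => cc u ω := fun ω => hccm.comp measurable_prodMk_right
  have hcc0 : ∀ u ω, 0 ≤ cc u ω := fun u ω => hc0 _ _ _
  have hccK : ∀ u ω, cc u ω ≤ K := fun u ω => hcK _ _ _
  have hccn : ∀ u ω, ‖cc u ω‖ ≤ K := fun u ω => by
    rw [Real.norm_of_nonneg (hcc0 u ω)]; exact hccK u ω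
  have hcci : ∀ ω a b, IntegrableOn (fun u => cc u ω) (Ioc a b) volume := fun ω a b =>
    Integrable.of_bound (hccω ω).aestronglyMeasurable K (Eventually.of_forall fun u => hccn u ω)
  have hK : 0 ≤ K := by
    have : Nonempty Ω := (inferInstance : NeZero μ).out |> fun h => by
      by_contra hne
      rw [not_nonempty_iff] at hne
      exact h (Measure.eq_zero_of_isEmpty μ)
    exact (hcc0 0 (Classical.arbitrary Ω)).trans (hccK 0 _)
  set C : ℝ → Set Ω := fun r => {ω | τ k ω ≤ r} ∩ {ω | τ (k+1) ω ≤ r}ᶜ with hC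
  have hCG : ∀ r, 0 ≤ r → MeasurableSet[Gi r] (C r) := fun r hr =>
    MeasurableSet.inter (hτG k r hr) (MeasurableSet.compl (hτG (k+1) r hr))
  have hCm : ∀ r, 0 ≤ r → MeasurableSet (C r) := fun r hr => hGi r hr _ (hCG r hr)
  have hCmem : ∀ r ω, ω ∈ C r ↔ τ k ω ≤ r ∧ r < τ (k+1) ω := fun r ω => by
    simp only [hC, mem_inter_iff, mem_compl_iff, mem_ofPred_eq, not_le]
  set S : ℕ → Ω → ℝ := fun n ω => ∑ i ∈ Finset.range (n+1), (C (grd s t n i)).indicator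
    (fun ω => (countX τ (grd s t n (i+1)) ω : ℝ) - countX τ (grd s t n i) ω) ω with hS
  set R : ℕ → Ω → ℝ := fun n ω => ∑ i ∈ Finset.range (n+1), (C (grd s t n i)).indicator
    (fun ω => ∫ u in Ioc (grd s t n i) (grd s t n (i+1)), cc u ω) ω with hR
  have hRint : ∀ a b, Measurable (fun ω => ∫ u in Ioc a b, cc u ω) := fun a b =>
    measurable_param_integral hccm _
  have hRi : ∀ a b, Integrable (fun ω => ∫ u in Ioc a b, cc u ω) μ := fun a b => by
    refine Integrable.of_bound (hRint a b).aestronglyMeasurable (K * volume.real (Ioc a b))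
      (Eventually.of_forall fun ω => ?_)
    exact norm_setIntegral_le_of_norm_le_const (by simp) (fun u _ => hccn u ω)
  have hXd : ∀ n i, Integrable (fun ω => (countX τ (grd s t n (i+1)) ω : ℝ) -
      countX τ (grd s t n i) ω) μ := fun n i => (hXi _ (hp0 _ _)).sub (hXi _ (hp0 _ _))
  have hSR : ∀ n, ∫ ω in B, S n ω ∂μ = ∫ ω in B, R n ω ∂μ := by
    intro n
    simp only [hS, hR]
    rw [integral_finsetSum _ fun i _ => ((hXd n i).indicator (hCm _ (hp0 n i))).integrableOn,
      integral_finsetSum _ fun i _ => ((hRi _ _).indicator (hCm _ (hp0 n i))).integrableOn]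
    refine Finset.sum_congr rfl fun i _ => ?_
    rw [setIntegral_indicator (hCm _ (hp0 n i)), setIntegral_indicator (hCm _ (hp0 n i))]
    exact hX _ _ (hp0 n i) (hps n i) _ (MeasurableSet.inter
      (hGm s _ hs (grd_ge hst n i) _ hB) (hCG _ (hp0 n i)))
  -- limit of `S`
  have hSlim : ∀ ω, Tendsto (fun n => S n ω) atTop
      (𝓝 ({ω | s < τ (k+1) ω ∧ τ (k+1) ω ≤ t}.indicator (fun _ => (1:ℝ)) ω)) := by
    intro ω
    have hmono := (hτ ω).2.1
    have hz : ∀ n i, ω ∈ C (grd s t n i) → grd s t n (i+1) < τ (k+1) ω →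
        (countX τ (grd s t n (i+1)) ω : ℝ) - countX τ (grd s t n i) ω = 0 := by
      intro n i h1 h2
      rw [hCmem] at h1
      rw [countX_eq hmono h1.1 h1.2, countX_eq hmono (h1.1.trans (hps n i)) h2, sub_self]
    refine tendsto_const_nhds.congr' ?_
    by_cases hω : s < τ (k+1) ω ∧ τ (k+1) ω ≤ t
    · have g1 : 0 < τ (k+1) ω - τ k ω := sub_pos.2 (hmono (Nat.lt_succ_self k))
      have g2 : 0 < τ (k+2) ω - τ (k+1) ω := sub_pos.2 (hmono (Nat.lt_succ_self (k+1)))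
      filter_upwards [mesh_small s t _ g1, mesh_small s t _ g2] with n h1 h2
      obtain ⟨i, hi, hi1, hi2⟩ := grd_exists n hω.1 hω.2
      rw [indicator_of_mem (show ω ∈ {ω | s < τ (k+1) ω ∧ τ (k+1) ω ≤ t} from hω)]
      simp only [hS]
      have e := grd_succ s t n i
      have hCi : ω ∈ C (grd s t n i) := by rw [hCmem]; exact ⟨by linarith, hi1⟩
      rw [Finset.sum_eq_single i]
      · rw [indicator_of_mem hCi, countX_eq hmono (k := k) (by linarith) hi1,
          countX_eq hmono (k := k + 1) hi2 (by linarith)]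
        push_cast; ring
      · intro j _ hji
        by_cases hj : ω ∈ C (grd s t n j)
        · rw [indicator_of_mem hj]
          refine hz n j hj ?_
          have hj' := (hCmem _ _).1 hj
          have := grd_unique hst hj'.2 hi2
          exact lt_of_le_of_lt (grd_mono hst n (show j + 1 ≤ i by omega)) hi1
        · rw [indicator_of_notMem hj]
      · intro h; exact absurd (Finset.mem_range.2 hi) h
    · refine Eventually.of_forall fun n => ?_
      rw [indicator_of_notMem (show ω ∉ {ω | s < τ (k+1) ω ∧ τ (k+1) ω ≤ t} from hω)]
      simp only [hS]
      refine (Finset.sum_eq_zero fun j hj => ?_).symm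
      by_cases hjC : ω ∈ C (grd s t n j)
      · rw [indicator_of_mem hjC]
        refine hz n j hjC ?_
        have hj' := (hCmem _ _).1 hjC
        have h1 : s < τ (k+1) ω := lt_of_le_of_lt (grd_ge hst n j) hj'.2
        have h2 : t < τ (k+1) ω := by
          by_contra h; exact hω ⟨h1, not_lt.1 h⟩
        exact lt_of_le_of_lt (grd_le hst (Nat.succ_le_of_lt (Finset.mem_range.1 hj))) h2
      · rw [indicator_of_notMem hjC]
  have hSbd : ∀ n ω, ‖S n ω‖ ≤ (countX τ t ω : ℝ) := by
    intro n ω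
    have hd : ∀ i, 0 ≤ (countX τ (grd s t n (i+1)) ω : ℝ) - countX τ (grd s t n i) ω := fun i => by
      have : (countX τ (grd s t n i) ω : ℝ) ≤ countX τ (grd s t n (i+1)) ω := by
        exact_mod_cast countX_mono hτ ω (hp0 n i) (hps n i)
      linarith
    have h0 : 0 ≤ S n ω := Finset.sum_nonneg fun i _ => indicator_nonneg (fun ω' _ => by
      have : (countX τ (grd s t n i) ω' : ℝ) ≤ countX τ (grd s t n (i+1)) ω' := by
        exact_mod_cast countX_mono hτ ω' (hp0 n i) (hps n i)
      linarith) _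
    rw [Real.norm_of_nonneg h0]
    calc S n ω ≤ ∑ i ∈ Finset.range (n+1),
          ((countX τ (grd s t n (i+1)) ω : ℝ) - countX τ (grd s t n i) ω) := by
          refine Finset.sum_le_sum fun i _ => ?_
          by_cases h : ω ∈ C (grd s t n i)
          · rw [indicator_of_mem h]
          · rw [indicator_of_notMem h]; exact hd i
      _ = (countX τ t ω : ℝ) - countX τ s ω := by
          rw [Finset.sum_range_sub (fun i => (countX τ (grd s t n i) ω : ℝ)), grd_last, grd_zero]
      _ ≤ _ := by
          have : (0:ℝ) ≤ countX τ s ω := by positivity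
          linarith
  have hSconv : Tendsto (fun n => ∫ ω in B, S n ω ∂μ) atTop
      (𝓝 (∫ ω in B, {ω | s < τ (k+1) ω ∧ τ (k+1) ω ≤ t}.indicator (fun _ => (1:ℝ)) ω ∂μ)) := by
    refine tendsto_integral_of_dominated_convergence (fun ω => (countX τ t ω : ℝ)) ?_
      (hXi t ht).integrableOn (fun n => Eventually.of_forall (hSbd n)) (Eventually.of_forall hSlim)
    intro n
    have : Integrable (S n) μ :=
      integrable_finsetSum _ fun i _ => (hXd n i).indicator (hCm _ (hp0 n i))
    exact this.aestronglyMeasurable.restrict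
  -- limit of `R`
  have hRform : ∀ n ω, R n ω = ∫ u in Ioc s t, ∑ i ∈ Finset.range (n+1),
      (C (grd s t n i)).indicator (fun ω => (Ioc (grd s t n i) (grd s t n (i+1))).indicator
        (fun u => cc u ω) u) ω := by
    intro n ω
    rw [integral_finsetSum]
    · simp only [hR]
      refine Finset.sum_congr rfl fun i hi => ?_
      by_cases h : ω ∈ C (grd s t n i)
      · simp only [indicator_of_mem h]
        rw [setIntegral_indicator measurableSet_Ioc, inter_eq_right.2]
        exact Ioc_subset_Ioc (grd_ge hst n i) (grd_le hst (Nat.succ_le_of_lt (Finset.mem_range.1 hi)))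
      · simp only [indicator_of_notMem h, integral_zero]
    · intro i _
      by_cases h : ω ∈ C (grd s t n i)
      · simp only [indicator_of_mem h]
        exact (hcci ω s t).indicator measurableSet_Ioc
      · simp only [indicator_of_notMem h]; exact integrable_zero _ _ _
  have hΦ : ∀ n ω u, u ∈ Ioc s t → ∃ i, grd s t n i < u ∧ u ≤ grd s t n (i+1) ∧
      ∑ i ∈ Finset.range (n+1),
      (C (grd s t n i)).indicator (fun ω => (Ioc (grd s t n i) (grd s t n (i+1))).indicator
        (fun u => cc u ω) u) ω = (C (grd s t n i)).indicator (fun ω => cc u ω) ω := by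
    intro n ω u hu
    obtain ⟨i, hi, hi1, hi2⟩ := grd_exists n hu.1 hu.2
    refine ⟨i, hi1, hi2, ?_⟩
    rw [Finset.sum_eq_single i]
    · simp only [indicator_of_mem (show u ∈ Ioc (grd s t n i) (grd s t n (i+1)) from ⟨hi1, hi2⟩)]
    · intro j _ hji
      have : u ∉ Ioc (grd s t n j) (grd s t n (j+1)) := fun h => hji
        (le_antisymm (grd_unique hst h.1 hi2) (grd_unique hst hi1 h.2))
      simp only [indicator_of_notMem this, indicator_zero]
    · intro h; exact absurd (Finset.mem_range.2 hi) h
  have hRlim : ∀ ω, Tendsto (fun n => R n ω) atTop (𝓝 (∫ u in Ioc s t,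
        if u ≤ τ (k+1) ω then (if τ k ω < u then c k u ω else 0) else 0)) := by
    intro ω
    have hmono := (hτ ω).2.1
    simp only [hRform]
    refine tendsto_integral_of_dominated_convergence (fun _ => K) ?_ (integrable_const _) ?_ ?_
    · intro n
      refine (Finset.measurable_fun_sum _ fun i _ => ?_).aestronglyMeasurable
      by_cases h : ω ∈ C (grd s t n i)
      · simp only [indicator_of_mem h]
        exact (hccω ω).indicator measurableSet_Ioc
      · simp only [indicator_of_notMem h]; exact measurable_const
    · intro n
      refine (ae_restrict_iff' measurableSet_Ioc).2 (Eventually.of_forall fun u hu => ?_)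
      obtain ⟨i, _, _, e⟩ := hΦ n ω u hu
      rw [e]
      by_cases h : ω ∈ C (grd s t n i)
      · rw [indicator_of_mem h]; exact hccn u ω
      · rw [indicator_of_notMem h]; simpa using hK
    · refine (ae_restrict_iff' measurableSet_Ioc).2 (Eventually.of_forall fun u hu => ?_)
      refine tendsto_const_nhds.congr' ?_
      have hu0 : 0 < u := lt_of_le_of_lt hs hu.1
      obtain ⟨j, hj1, hj2⟩ := exists_idx' hτ ω hu0
      filter_upwards [mesh_small s t _ (sub_pos.2 hj1)] with n hn
      obtain ⟨i, hi1, hi2, e⟩ := hΦ n ω u hu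
      rw [e]
      have e2 := grd_succ s t n i
      have hcX : countX τ (grd s t n i) ω = j :=
        countX_eq hmono (by linarith) (lt_of_lt_of_le hi1 hj2)
      have hcXm : countXminus τ u ω = j := countXminus_eq hmono hj1 hj2
      by_cases h : ω ∈ C (grd s t n i)
      · rw [indicator_of_mem h]
        rw [hCmem, ← countX_iff hτ ω (hp0 n i), hcX] at h
        subst h
        simp only [hcc, hcXm, hj1, hj2, if_true]
      · rw [indicator_of_notMem h]
        rw [hCmem, ← countX_iff hτ ω (hp0 n i), hcX] at h
        by_contra hne
        apply h
        rw [← hcXm, countXminus_iff hτ ω hu0]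
        split_ifs at hne with h1 h2
        · exact ⟨h2, h1⟩
        · exact absurd rfl hne
        · exact absurd rfl hne
  have hRconv : Tendsto (fun n => ∫ ω in B, R n ω ∂μ) atTop
      (𝓝 (∫ ω in B, (∫ u in Ioc s t,
        if u ≤ τ (k+1) ω then (if τ k ω < u then c k u ω else 0) else 0) ∂μ)) := by
    refine tendsto_integral_of_dominated_convergence (fun _ => K * volume.real (Ioc s t)) ?_
      (integrable_const _) (fun n => Eventually.of_forall fun ω => ?_) (Eventually.of_forall hRlim)
    · intro n
      have : Integrable (R n) μ :=
        integrable_finsetSum _ fun i _ => (hRi _ _).indicator (hCm _ (hp0 n i))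
      exact this.aestronglyMeasurable.restrict
    · rw [hRform]
      refine norm_setIntegral_le_of_norm_le_const (by simp) (fun u hu => ?_)
      obtain ⟨i, _, _, e⟩ := hΦ n ω u hu
      rw [e]
      by_cases h : ω ∈ C (grd s t n i)
      · rw [indicator_of_mem h]; exact hccn u ω
      · rw [indicator_of_notMem h]; simpa using hK
  have hfin := tendsto_nhds_unique (hSconv.congr hSR) hRconv
  rw [← hfin]
  have hms : MeasurableSet {ω | s < τ (k+1) ω ∧ τ (k+1) ω ≤ t} :=
    (measurableSet_lt measurable_const (hτm _)).inter (measurableSet_le (hτm _) measurable_const)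
  rw [integral_indicator hms, Measure.restrict_restrict hms, inter_comm]
  simp

lemma measurable_of_ae_eq_sub {m0 : MeasurableSpace Ω} (μ : Measure Ω) {m : MeasurableSpace Ω}
    (hnull : ∀ s : Set Ω, μ s = 0 → MeasurableSet[m] s) {β : Type*} [MeasurableSpace β]
    {f g : Ω → β} (hg : Measurable[m] g) (hfg : f =ᵐ[μ] g) : Measurable[m] f := by
  intro S hS
  have hN : μ {ω | f ω ≠ g ω} = 0 := hfg
  have e : f ⁻¹' S = (g ⁻¹' S \ {ω | f ω ≠ g ω}) ∪ (f ⁻¹' S ∩ {ω | f ω ≠ g ω}) := by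
    ext ω
    by_cases h : f ω = g ω <;> simp [h]
  rw [e]
  exact MeasurableSet.union (MeasurableSet.diff (hg hS) (hnull _ hN))
    (hnull _ (measure_mono_null inter_subset_right hN))

lemma measurableSet_of_ae_eq_sub {m0 : MeasurableSpace Ω} (μ : Measure Ω) {m : MeasurableSpace Ω}
    (hnull : ∀ s : Set Ω, μ s = 0 → MeasurableSet[m] s) {A B N : Set Ω} (hN : μ N = 0)
    (hB : MeasurableSet[m] B) (hAB : ∀ ω, ω ∉ N → (ω ∈ A ↔ ω ∈ B)) : MeasurableSet[m] A := by
  have e : A = (B \ N) ∪ (A ∩ N) := by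
    ext ω
    by_cases h : ω ∈ N
    · simp [h]
    · simp [h, hAB ω h]
  rw [e]
  exact MeasurableSet.union (MeasurableSet.diff hB (hnull _ hN))
    (hnull _ (measure_mono_null inter_subset_right hN))

lemma rcReg_mono (F : ℝ → MeasurableSpace Ω) {s t : ℝ} (hst : s ≤ t) : rcReg F s ≤ rcReg F t := by
  intro A hA
  rw [measurableSet_rcReg] at *
  exact fun r hr => hA r (hst.trans_lt hr)

lemma rcReg_idem (F : ℝ → MeasurableSpace Ω) (t : ℝ) : rcReg F t = rcReg (rcReg F) t := by
  ext A
  simp only [measurableSet_rcReg]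
  constructor
  · exact fun h s hs r hr => h r (hs.trans hr)
  · intro h s hs
    obtain ⟨r, hr1, hr2⟩ := exists_between hs
    exact h r hr1 s hr2

lemma setup_facts {m0 : MeasurableSpace Ω} (μ : Measure Ω) [IsProbabilityMeasure μ]
    (F : ℝ → MeasurableSpace Ω) (hUC : UsualConditions μ F)
    (τ : ℕ → Ω → ℝ) (hτ0 : ∀ ω, τ 0 ω = 0)
    (hτincr : ∀ᵐ ω ∂μ, (0 < τ 1 ω) ∧ StrictMono (fun k => τ k ω) ∧
      Tendsto (fun k => τ k ω) atTop atTop)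
    (G : ℕ → ℝ → MeasurableSpace Ω)
    (hG : ∀ k : ℕ, G k = rcReg (fun t => F t ⊔
      ⨆ i ∈ Finset.range k, natFilt (fun s ω => if τ (i + 1) ω ≤ s then (1:ℝ) else 0) t))
    (Gi : ℝ → MeasurableSpace Ω)
    (hGi : Gi = rcReg (fun t => F t ⊔
      ⨆ i : ℕ, natFilt (fun s ω => if τ (i + 1) ω ≤ s then (1:ℝ) else 0) t))
    (hZ : ∀ k : ℕ, ∃ Z : ℝ → Ω → ℝ,
      (∀ ω, Continuous fun t => Z t ω) ∧ (∀ t ω, 0 < Z t ω) ∧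
      ∀ t : ℝ, 0 ≤ t →
        Z t =ᵐ[μ] μ[(fun ω => if t < τ (k + 1) ω then (1:ℝ) else 0) | G k t]) :
    (∀ k, UsualConditions μ (G k)) ∧ (∀ k, Measurable (τ k)) ∧
    (∀ s t, 0 ≤ s → s ≤ t → Gi s ≤ Gi t) ∧ (∀ t, 0 ≤ t → Gi t ≤ m0) ∧
    (∀ s, μ s = 0 → MeasurableSet[Gi 0] s) ∧
    (∀ k q t, 0 ≤ t → q ≤ t → MeasurableSet[Gi t] {ω | τ k ω ≤ q}) ∧
    (∀ k i q t, i ≤ k → 0 ≤ t → q ≤ t → MeasurableSet[G k t] {ω | τ i ω ≤ q}) ∧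
    (∀ k t, 0 ≤ t → F t ≤ G k t) := by
  obtain ⟨⟨hFm, hF0⟩, hFrc, hFnull⟩ := hUC
  have hcompl : ∀ s, μ s = 0 → MeasurableSet s := fun s hs => hF0 0 _ (hFnull s hs)
  have : μ.IsComplete := ⟨hcompl⟩
  have hne : ∀ (f : Ω → ℝ), (∀ ω, 0 < f ω) → ¬ f =ᵐ[μ] 0 := by
    intro f hf h
    have : ∀ᵐ ω ∂μ, False := by
      filter_upwards [h] with ω hω
      have := hf ω; rw [hω] at this; exact lt_irrefl _ this
    have h2 := this.exists
    exact h2.choose_spec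
  have hpos : ∀ k, ∀ᵐ ω ∂μ, 0 < τ (k+1) ω := by
    intro k
    filter_upwards [hτincr] with ω hω
    have := hω.2.1 (Nat.succ_pos k)
    simpa [hτ0] using this
  -- measurability of `τ`
  have hτm : ∀ k, Measurable (τ k) := by
    intro k
    rcases k with _ | k
    · have : τ 0 = fun _ => 0 := funext hτ0
      rw [this]; exact measurable_const
    obtain ⟨Z, _, hZp, hZe⟩ := hZ k
    have h1 : ∀ t, 0 ≤ t → MeasurableSet {ω | t < τ (k+1) ω} := by
      intro t ht
      have hi : Integrable (fun ω => if t < τ (k + 1) ω then (1:ℝ) else 0) μ := by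
        by_contra hcon
        have h := hZe t ht
        rw [condExp_of_not_integrable hcon] at h
        exact hne _ (hZp t) h
      have h2 : NullMeasurableSet ((fun ω => if t < τ (k + 1) ω then (1:ℝ) else 0) ⁻¹' {1}) μ :=
        hi.aestronglyMeasurable.aemeasurable.nullMeasurable (measurableSet_singleton 1)
      have h3 := h2.measurable_of_complete
      convert h3 using 1
      ext ω
      by_cases h : t < τ (k+1) ω <;> simp [h]
    refine measurable_of_Ioi fun t => ?_
    rcases le_or_gt 0 t with ht | ht
    · exact h1 t ht
    · refine measurableSet_of_ae_eq_sub μ hcompl (N := {ω | ¬ 0 < τ (k+1) ω}) (hpos k)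
        MeasurableSet.univ fun ω hω => ?_
      simp only [mem_ofPred_eq, not_not] at hω
      simp only [mem_preimage, mem_Ioi, mem_univ, iff_true]
      linarith
  have hGk0 : ∀ k t, 0 ≤ t → G k t ≤ m0 := by
    intro k t ht
    by_contra hcon
    obtain ⟨Z, _, hZp, hZe⟩ := hZ k
    have h := hZe t ht
    rw [condExp_of_not_le hcon] at h
    exact hne _ (hZp t) h
  have hnat : ∀ i t, natFilt (fun s ω => if τ (i + 1) ω ≤ s then (1:ℝ) else 0) t ≤ m0 := by
    intro i t
    refine iSup₂_le fun s _ => ?_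
    rw [← measurable_iff_comap_le]
    exact Measurable.ite (measurableSet_le (hτm _) measurable_const) measurable_const
      measurable_const
  have hset : ∀ i q s, 0 ≤ q → q ≤ s → MeasurableSet[natFilt
      (fun s ω => if τ (i + 1) ω ≤ s then (1:ℝ) else 0) s] {ω | τ (i+1) ω ≤ q} := by
    intro i q s hq hqs
    have h1 : MeasurableSpace.comap (fun ω => if τ (i + 1) ω ≤ q then (1:ℝ) else 0) inferInstance ≤
        natFilt (fun s ω => if τ (i + 1) ω ≤ s then (1:ℝ) else 0) s :=
      le_iSup₂_of_le (f := fun r (_ : r ∈ Icc 0 s) => MeasurableSpace.comap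
        (fun ω => if τ (i + 1) ω ≤ r then (1:ℝ) else 0) inferInstance) q ⟨hq, hqs⟩ le_rfl
    refine h1 _ ⟨{1}, measurableSet_singleton 1, ?_⟩
    ext ω
    by_cases h : τ (i+1) ω ≤ q <;> simp [h]
  have hFle : ∀ k t, 0 ≤ t → F t ≤ G k t := by
    intro k t ht A hA
    rw [hG, measurableSet_rcReg]
    intro s hs
    exact (le_sup_left : F s ≤ _) _ (hFm t s ht hs.le _ hA)
  have hFleGi : ∀ t, 0 ≤ t → F t ≤ Gi t := by
    intro t ht A hA
    rw [hGi, measurableSet_rcReg]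
    intro s hs
    exact (le_sup_left : F s ≤ _) _ (hFm t s ht hs.le _ hA)
  have hneg : ∀ i q, q < 0 → μ {ω | τ (i+1) ω ≤ q} = 0 := by
    intro i q hq
    refine measure_mono_null (fun ω hω => ?_) (hpos i)
    simp only [mem_ofPred_eq] at hω
    simp only [mem_compl_iff, mem_ofPred_eq, not_lt]
    linarith
  have h0set : ∀ (m : MeasurableSpace Ω) q, MeasurableSet[m] {ω | τ 0 ω ≤ q} := by
    intro m q
    simp only [hτ0]
    exact MeasurableSet.const _
  refine ⟨?_, hτm, ?_, ?_, ?_, ?_, ?_, hFle⟩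
  · intro k
    refine ⟨⟨?_, ?_⟩, ?_, ?_⟩
    · intro s t _ hst
      rw [hG]; exact rcReg_mono _ hst
    · intro t
      rcases le_or_gt 0 t with ht | ht
      · exact hGk0 k t ht
      · refine le_trans ?_ (hGk0 k 0 le_rfl)
        rw [hG]; exact rcReg_mono _ ht.le
    · intro t _
      rw [hG]; exact rcReg_idem _ t
    · exact fun s hs => hFle k 0 le_rfl _ (hFnull s hs)
  · intro s t _ hst
    rw [hGi]; exact rcReg_mono _ hst
  · intro t ht A hA
    rw [hGi, measurableSet_rcReg] at hA
    have h := hA (t+1) (by linarith)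
    exact (sup_le (hF0 _) (iSup_le fun i => hnat i _)) _ h
  · exact fun s hs => hFleGi 0 le_rfl _ (hFnull s hs)
  · intro k q t ht hqt
    rcases k with _ | i
    · exact h0set _ q
    rcases lt_or_ge q 0 with hq | hq
    · exact hFleGi t ht _ (hFm 0 t le_rfl ht _ (hFnull _ (hneg i q hq)))
    · rw [hGi, measurableSet_rcReg]
      intro s hs
      refine (le_sup_right : _ ≤ F s ⊔ _) _ ?_
      exact (le_iSup (fun i : ℕ => natFilt (fun s ω => if τ (i + 1) ω ≤ s then (1:ℝ) else 0) s) i) _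
        (hset i q s hq (hqt.trans hs.le))
  · intro k i q t hik ht hqt
    rcases i with _ | i
    · exact h0set _ q
    rcases lt_or_ge q 0 with hq | hq
    · exact hFle k t ht _ (hFm 0 t le_rfl ht _ (hFnull _ (hneg i q hq)))
    · rw [hG, measurableSet_rcReg]
      intro s hs
      refine (le_sup_right : _ ≤ F s ⊔ _) _ ?_
      exact (le_iSup₂_of_le (f := fun i (_ : i ∈ Finset.range k) =>
        natFilt (fun s ω => if τ (i + 1) ω ≤ s then (1:ℝ) else 0) s) i
        (Finset.mem_range.2 hik) le_rfl) _ (hset i q s hq (hqt.trans hs.le))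

lemma measurableSet_lt_min [MeasurableSpace Ω] (T : Ω → ℝ) (t : ℝ)
    (h : ∀ q, q ≤ t → MeasurableSet {ω | T ω ≤ q}) :
    MeasurableSet {p : ℝ × Ω | T p.2 < min p.1 t} := by
  have e : {p : ℝ × Ω | T p.2 < min p.1 t} = ⋃ q : {q : ℚ // (q : ℝ) < t},
      (Ioi (q.1 : ℝ)) ×ˢ {ω | T ω ≤ q.1} := by
    ext p
    simp only [mem_ofPred_eq, mem_iUnion, mem_prod, mem_Ioi]
    constructor
    · intro hp
      obtain ⟨q, h1, h2⟩ := exists_rat_btwn hp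
      exact ⟨⟨q, lt_of_lt_of_le h2 (min_le_right _ _)⟩, lt_of_lt_of_le h2 (min_le_left _ _), h1.le⟩
    · rintro ⟨⟨q, hq⟩, h1, h2⟩
      exact lt_of_le_of_lt h2 (lt_min h1 hq)
  rw [e]
  exact MeasurableSet.iUnion fun q => measurableSet_Ioi.prod (h _ q.2.le)

lemma measurable_ite_param [MeasurableSpace Ω] {S : Set (ℝ × Ω)} (hS : MeasurableSet S)
    {f : ℝ × Ω → ℝ} (hf : Measurable f) : Measurable (S.indicator f) := hf.indicator hS

lemma core {m0 : MeasurableSpace Ω} (μ : Measure Ω) [IsProbabilityMeasure μ]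
    (G : ℕ → ℝ → MeasurableSpace Ω) (hG : ∀ k, UsualConditions μ (G k))
    {Gi : ℝ → MeasurableSpace Ω} (hGm : ∀ s t, 0 ≤ s → s ≤ t → Gi s ≤ Gi t)
    (hGi : ∀ t, 0 ≤ t → Gi t ≤ m0) (himm : ∀ k, Immersed μ (G k) Gi)
    (τ : ℕ → Ω → ℝ) (hτ : GoodT τ) (hτm : ∀ k, Measurable (τ k))
    (hτGi : ∀ k t, 0 ≤ t → MeasurableSet[Gi t] {ω | τ k ω ≤ t})
    (hτG : ∀ k q t, 0 ≤ t → q ≤ t → MeasurableSet[G k t] {ω | τ k ω ≤ q})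
    (hZ : ∀ k : ℕ, ∃ Z : ℝ → Ω → ℝ,
      (∀ ω, Continuous fun t => Z t ω) ∧ (∀ t ω, 0 < Z t ω) ∧
      ∀ t : ℝ, 0 ≤ t →
        Z t =ᵐ[μ] μ[{ω | t < τ (k+1) ω}.indicator (fun _ => (1:ℝ)) | G k t])
    (c : ℕ → ℝ → Ω → ℝ) (a K : ℝ) (ha : 0 < a) (hK : 0 < K) (hcp : ∀ k, ProgC (G k) (c k))
    (hca : ∀ k t ω, a ≤ c k t ω) (hcK : ∀ k t ω, c k t ω ≤ K)
    (hXi : ∀ t, 0 ≤ t → Integrable (fun ω => (countX τ t ω : ℝ)) μ)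
    (hX : ∀ s t, 0 ≤ s → s ≤ t → ∀ B, MeasurableSet[Gi s] B →
      ∫ ω in B, ((countX τ t ω : ℝ) - countX τ s ω) ∂μ =
        ∫ ω in B, (∫ u in Ioc s t, c (countXminus τ u ω) u ω) ∂μ)
    (k : ℕ) (s0 : ℝ) (hs0 : 0 ≤ s0) (A : Set Ω) (hA : MeasurableSet[G k s0] A)
    (x : ℝ) (hx : 0 ≤ x) :
    μ (A ∩ {ω | x < ∫ u in Ioc (τ k ω) (τ (k+1) ω), c k u ω}) =
      μ A * ENNReal.ofReal (Real.exp (-x)) := by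
  have hH : IsFiltration m0 (G k) := (hG k).1
  have hc0 : ∀ k t ω, 0 ≤ c k t ω := fun k t ω => ha.le.trans (hca k t ω)
  have hcm : ∀ k, Measurable (fun p : ℝ × Ω => c k p.1 p.2) := fun k => (hcp k).measurable (hG k).1
  have hτnn : ∀ ω j, 0 ≤ τ j ω := fun ω j => by
    have := (hτ ω).2.1.monotone (Nat.zero_le j)
    simpa [(hτ ω).1] using this
  have hτpos : ∀ ω, 0 < τ (k+1) ω := fun ω =>
    lt_of_le_of_lt (hτnn ω k) ((hτ ω).2.1 (Nat.lt_succ_self k))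
  set c' : ℝ → Ω → ℝ := fun u ω => if τ k ω < u then c k u ω else 0 with hc'
  have hc'0 : ∀ u ω, 0 ≤ c' u ω := fun u ω => by
    simp only [hc']; split_ifs; exacts [hc0 _ _ _, le_rfl]
  have hc'K : ∀ u ω, c' u ω ≤ K := fun u ω => by
    simp only [hc']; split_ifs; exacts [hcK _ _ _, hK.le]
  have hc'p : ProgC (G k) c' := by
    intro t ht
    have h1 := @measurableSet_lt_min Ω (G k t) (τ k) t (fun q hq => hτG k q t ht hq)
    have h2 := @measurable_ite_param Ω (G k t) _ h1 _ (hcp k t ht)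
    refine Eq.mp ?_ h2
    congr 1
  obtain ⟨Z, hZc, hZp, hZe⟩ := hZ k
  have hmono : ∀ s t, 0 ≤ s → s ≤ t → G k s ≤ G k t := hH.1
  have hTset : ∀ t, 0 ≤ t → MeasurableSet[Gi t] {ω | t < τ (k+1) ω} := by
    intro t ht
    have := MeasurableSet.compl (hτGi (k+1) t ht)
    convert this using 1
    ext ω; simp
  have h1 : ∀ s t, 0 ≤ s → 0 ≤ t → ∀ A, MeasurableSet[G k s] A →
      μ.real (A ∩ {ω | t < τ (k+1) ω}) = ∫ ω in A, Z (max t 0) ω ∂μ := by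
    intro s t hs ht A hA
    rw [max_eq_left ht]
    have hAm : MeasurableSet[G k (max s t)] A := hmono s _ hs (le_max_left _ _) _ hA
    rw [immersion_cond μ (hG k) hGi (himm k) ht (le_max_right s t) hAm (hTset t ht)]
    refine integral_congr_ae (ae_restrict_of_ae ?_)
    exact (hZe t ht).symm
  have hexp := exp_formula μ hH (τ (k+1)) (hτm _) (Eventually.of_forall hτpos)
    (fun t => Z (max t 0)) (fun ω => (hZc ω).comp (continuous_id.max continuous_const))
    (fun t ω => hZp _ ω)
    (fun t => measurable_of_ae_eq_sub μ (fun s hs => hmono 0 _ le_rfl (le_max_right _ _) _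
      ((hG k).2.2 s hs)) (stronglyMeasurable_condExp).measurable (hZe _ (le_max_right t 0)))
    (fun t ht => integrable_condExp.congr (hZe _ (le_max_right t 0)).symm) h1 c' K hc'p hc'0 hc'K
    (by
      intro s t hs hst B hB
      exact jump_formula μ hGm hGi τ hτ hτm hτGi c K hcm hc0 hcK hXi hX k s t hs hst B
        ((himm k).1 s hs _ hB))
  have hcmω : ∀ ω, Measurable fun u => c k u ω := fun ω => (hcm k).comp measurable_prodMk_right
  have hci : ∀ ω a b, IntegrableOn (fun u => c k u ω) (Ioc a b) volume := fun ω a b =>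
    Integrable.of_bound (hcmω ω).aestronglyMeasurable K (Eventually.of_forall fun u => by
      rw [Real.norm_of_nonneg (hc0 _ _ _)]; exact hcK _ _ _)
  have hform : ∀ ω t, ∫ u in Ioc 0 t, c' u ω = ∫ u in Ioc (τ k ω) t, c k u ω := by
    intro ω t
    have e : (fun u => c' u ω) = (Ioi (τ k ω)).indicator (fun u => c k u ω) := by
      ext u; simp [hc', indicator]
    rw [e, setIntegral_indicator measurableSet_Ioi]
    congr 2
    ext u
    simp only [mem_inter_iff, mem_Ioc, mem_Ioi]
    exact ⟨fun h => ⟨h.2, h.1.2⟩, fun h => ⟨⟨(hτnn ω k).trans_lt h.1, h.2⟩, h.1⟩⟩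
  have hinf : ∀ ω, Tendsto (fun t : ℝ => ∫ u in Ioc 0 t, c' u ω) atTop atTop := by
    intro ω
    have h3 : Tendsto (fun t : ℝ => a * (t - τ k ω)) atTop atTop :=
      (tendsto_atTop_add_const_right _ _ tendsto_id).const_mul_atTop ha
    refine tendsto_atTop_mono' _ ?_ h3
    filter_upwards [eventually_ge_atTop (τ k ω)] with t ht
    rw [hform]
    calc a * (t - τ k ω) = ∫ u in Ioc (τ k ω) t, a := by simp [ht, mul_comm]
      _ ≤ _ := setIntegral_mono_on (integrable_const _) (hci _ _ _) measurableSet_Ioc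
          fun u _ => hca _ _ _
  have hfin := exp_indep μ hH (τ (k+1)) (hτm _) (Eventually.of_forall hτpos) c' K hK hc'p hc'0 hc'K
    (by
      intro s t hs ht A hA
      rw [h1 s t hs ht A hA]
      refine integral_congr_ae (ae_restrict_of_ae ?_)
      filter_upwards [hexp] with ω hω
      exact hω t ht) (Eventually.of_forall hinf) s0 hs0 A hA x hx
  simp only [hform] at hfin
  exact hfin

lemma Finfty_eq {H : ℝ → MeasurableSpace Ω} :
    Finfty H = ⨆ t : Ici (0:ℝ), H t := by
  rw [Finfty, iSup_subtype']

lemma le_Finfty (H : ℝ → MeasurableSpace Ω) {t : ℝ} (ht : 0 ≤ t) : H t ≤ Finfty H :=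
  le_iSup₂_of_le (f := fun t (_ : t ∈ Ici (0:ℝ)) => H t) t ht le_rfl

lemma indep_step {m0 : MeasurableSpace Ω} (μ : Measure Ω) [IsProbabilityMeasure μ]
    {H : ℝ → MeasurableSpace Ω} (hH : IsFiltration m0 H) (E : Ω → ℝ) (hEm : Measurable E)
    (hE : ∀ s, 0 ≤ s → ∀ A, MeasurableSet[H s] A → ∀ x, 0 ≤ x →
      μ (A ∩ {ω | x < E ω}) = μ A * ENNReal.ofReal (Real.exp (-x))) :
    Indep (Finfty H) (MeasurableSpace.comap E inferInstance) μ := by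
  have hx : ∀ x, 0 ≤ x → μ {ω | x < E ω} = ENNReal.ofReal (Real.exp (-x)) := by
    intro x hx
    have := hE 0 le_rfl univ MeasurableSet.univ x hx
    simpa using this
  have hpos : ∀ᵐ ω ∂μ, 0 < E ω := by
    have h := hx 0 le_rfl
    rw [neg_zero, Real.exp_zero, ENNReal.ofReal_one] at h
    rw [← prob_compl_eq_zero_iff (measurableSet_lt measurable_const hEm)] at h
    exact h
  rw [Finfty_eq]
  refine indep_iSup_of_directed_le ?_ (fun i => hH.2 _) hEm.comap_le ?_
  · intro i
    have hgen : MeasurableSpace.comap E inferInstance =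
        MeasurableSpace.generateFrom (preimage E '' range Ioi) := by
      rw [← MeasurableSpace.comap_generateFrom, ← borel_eq_generateFrom_Ioi,
        BorelSpace.measurable_eq (α := ℝ)]
    have hpi : IsPiSystem (preimage E '' (range Ioi : Set (Set ℝ))) := by
      rintro _ ⟨_, ⟨x, rfl⟩, rfl⟩ _ ⟨_, ⟨y, rfl⟩, rfl⟩ _
      refine ⟨_, ⟨max x y, rfl⟩, ?_⟩
      rw [← preimage_inter, Ioi_inter_Ioi]
      
    refine IndepSets.indep (p1 := {A | MeasurableSet[H i] A}) (hH.2 _) hEm.comap_le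
      (@MeasurableSpace.isPiSystem_measurableSet Ω (H i)) hpi
      (@MeasurableSpace.generateFrom_measurableSet Ω (H i)).symm hgen ?_
    rw [IndepSets_iff]
    rintro A _ hA ⟨_, ⟨x, rfl⟩, rfl⟩
    show μ (A ∩ {ω | x < E ω}) = μ A * μ {ω | x < E ω}
    rcases le_or_gt 0 x with h | h
    · rw [hE i i.2 A hA x h, hx x h]
    · have e1 : μ (A ∩ {ω | x < E ω}) = μ A := by
        refine measure_congr ?_
        filter_upwards [hpos] with ω hω
        refine eq_iff_iff.2 ⟨fun h => h.1, fun h' => ⟨h', ?_⟩⟩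
        exact h.trans hω
      have e2 : μ {ω | x < E ω} = 1 := by
        rw [← prob_compl_eq_zero_iff (measurableSet_lt measurable_const hEm)]
        refine measure_mono_null ?_ hpos
        intro ω hω h'
        exact hω (h.trans h')
      rw [e1, e2, mul_one]
  · intro i j
    refine ⟨⟨max i.1 j.1, i.2.out.trans (le_max_left _ _)⟩, ?_, ?_⟩
    · exact hH.1 _ _ i.2 (le_max_left _ _)
    · exact hH.1 _ _ j.2 (le_max_right _ _)

lemma indep_concl {m0 : MeasurableSpace Ω} (μ : Measure Ω) [IsProbabilityMeasure μ]
    (F : ℝ → MeasurableSpace Ω) (G : ℕ → ℝ → MeasurableSpace Ω)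
    (hG : ∀ k, IsFiltration m0 (G k)) (hFG : ∀ t, 0 ≤ t → F t ≤ G 0 t)
    (hGG : ∀ k t, 0 ≤ t → G k t ≤ G (k+1) t)
    (E : ℕ → Ω → ℝ) (hEm : ∀ k, Measurable[Finfty (G (k+1))] (E k))
    (hE : ∀ k s, 0 ≤ s → ∀ A, MeasurableSet[G k s] A → ∀ x, 0 ≤ x →
      μ (A ∩ {ω | x < E k ω}) = μ A * ENNReal.ofReal (Real.exp (-x))) :
    iIndep (fun i : Option ℕ =>
      Option.elim i (Finfty F)
        (fun k => MeasurableSpace.comap (E k) inferInstance)) μ := by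
  have hle : ∀ k, Finfty (G k) ≤ m0 := fun k => iSup₂_le fun t _ => (hG k).2 t
  have hEm0 : ∀ k, Measurable (E k) := fun k => (hEm k).mono (hle _) le_rfl
  have hI : ∀ k, Indep (Finfty (G k)) (MeasurableSpace.comap (E k) inferInstance) μ :=
    fun k => indep_step μ (hG k) (E k) (hEm0 k) (hE k)
  have hGmono : Monotone fun k => Finfty (G k) :=
    monotone_nat_of_le_succ fun k => iSup₂_mono fun t ht => hGG k t ht
  have hF0 : Finfty F ≤ Finfty (G 0) := iSup₂_mono fun t ht => hFG t ht
  have key : ∀ (A : Set Ω) (B : ℕ → Set Ω), MeasurableSet[Finfty F] A →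
      (∀ k, MeasurableSet[MeasurableSpace.comap (E k) inferInstance] (B k)) → ∀ n,
      MeasurableSet[Finfty (G n)] (A ∩ ⋂ k ∈ Finset.range n, B k) ∧
      μ (A ∩ ⋂ k ∈ Finset.range n, B k) = μ A * ∏ k ∈ Finset.range n, μ (B k) := by
    intro A B hA hB n
    induction n with
    | zero => simpa using hF0 _ hA
    | succ n ih =>
      have e : A ∩ ⋂ k ∈ Finset.range (n+1), B k = (A ∩ ⋂ k ∈ Finset.range n, B k) ∩ B n := by
        ext ω
        simp only [mem_inter_iff, mem_iInter, Finset.mem_range]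
        constructor
        · rintro ⟨h1, h2⟩
          exact ⟨⟨h1, fun i hi => h2 i (by omega)⟩, h2 n (by omega)⟩
        · rintro ⟨⟨h1, h2⟩, h3⟩
          refine ⟨h1, fun i hi => ?_⟩
          rcases Nat.lt_succ_iff_lt_or_eq.1 hi with h | rfl
          · exact h2 i h
          · exact h3
      rw [e]
      refine ⟨MeasurableSet.inter (hGmono (Nat.le_succ n) _ ih.1) ((hEm n).comap_le _ (hB n)), ?_⟩
      rw [(Indep_iff _ _ _).1 (hI n) _ _ ih.1 (hB n), ih.2, Finset.prod_range_succ, mul_assoc]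
  rw [iIndep_iff]
  intro s f hf
  classical
  set f' : Option ℕ → Set Ω := fun i => if i ∈ s then f i else univ with hf'
  have hf'm : ∀ i, MeasurableSet[Option.elim i (Finfty F)
        (fun k => MeasurableSpace.comap (E k) inferInstance)] (f' i) := by
    intro i
    by_cases h : i ∈ s
    · simp only [hf', h, if_true]; exact hf i h
    · simp only [hf', h, if_false]; exact MeasurableSet.univ
  obtain ⟨n, hn⟩ : ∃ n, ∀ k, some k ∈ s → k < n := by
    refine ⟨(Finset.eraseNone s).sup id + 1, fun k hk => ?_⟩
    have : k ∈ Finset.eraseNone s := by simpa using hk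
    exact Nat.lt_succ_of_le (Finset.le_sup (f := id) this)
  have hsub : s ⊆ Finset.insertNone (Finset.range n) := by
    intro i hi
    rw [Finset.mem_insertNone]
    intro k hk
    rw [Option.mem_def] at hk
    subst hk
    exact Finset.mem_range.2 (hn k hi)
  have e1 : ⋂ i ∈ s, f i = f' none ∩ ⋂ k ∈ Finset.range n, f' (some k) := by
    ext ω
    simp only [mem_inter_iff, mem_iInter, hf', Finset.mem_range]
    constructor
    · intro h
      refine ⟨?_, fun k _ => ?_⟩
      · split_ifs with h1
        · exact h _ h1
        · trivial
      · split_ifs with h1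
        · exact h _ h1
        · trivial
    · rintro ⟨h1, h2⟩ i hi
      rcases i with _ | k
      · rwa [if_pos hi] at h1
      · have := h2 k (hn k hi)
        rwa [if_pos hi] at this
  rw [e1, (key _ (fun k => f' (some k)) (hf'm none) (fun k => hf'm (some k)) n).2,
    ← Finset.prod_insertNone (fun i => μ (f' i))]
  rw [← Finset.prod_subset hsub]
  · refine Finset.prod_congr rfl fun i hi => ?_
    simp only [hf', hi, if_true]
  · intro i _ hi
    simp [hf', hi]

lemma exists_good_tau {m0 : MeasurableSpace Ω} (μ : Measure Ω)
    (τ : ℕ → Ω → ℝ) (hτ0 : ∀ ω, τ 0 ω = 0)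
    (hτincr : ∀ᵐ ω ∂μ, (0 < τ 1 ω) ∧ StrictMono (fun k => τ k ω) ∧
      Tendsto (fun k => τ k ω) atTop atTop) :
    ∃ τ' : ℕ → Ω → ℝ, GoodT τ' ∧ ∀ᵐ ω ∂μ, ∀ k, τ k ω = τ' k ω := by
  classical
  refine ⟨fun k ω => if StrictMono (fun k => τ k ω) ∧ Tendsto (fun k => τ k ω) atTop atTop
    then τ k ω else k, ?_, ?_⟩
  · intro ω
    by_cases h : StrictMono (fun k => τ k ω) ∧ Tendsto (fun k => τ k ω) atTop atTop
    · simp only [if_pos h]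
      exact ⟨hτ0 ω, h⟩
    · simp only [h, if_false]
      exact ⟨by simp, fun a b hab => by simpa using hab, tendsto_natCast_atTop_atTop⟩
  · filter_upwards [hτincr] with ω h k
    simp [h.2.1, h.2.2]

lemma condExp_atom {m0 : MeasurableSpace Ω} (μ : Measure Ω) [IsProbabilityMeasure μ]
    (Y : Ω → ℕ) (hY : Measurable Y) (f : Ω → ℝ) (hf : Integrable f μ) (ω : Ω)
    (h : μ {ω' | Y ω' = Y ω} ≠ 0) :
    (μ[f | MeasurableSpace.comap Y inferInstance]) ω =
      (∫ ω', (if Y ω' = Y ω then f ω' else 0) ∂μ) / (μ {ω' | Y ω' = Y ω}).toReal := by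
  have hm : MeasurableSpace.comap Y inferInstance ≤ m0 := hY.comap_le
  have hsm : StronglyMeasurable[MeasurableSpace.comap Y inferInstance]
      (μ[f | MeasurableSpace.comap Y inferInstance]) := stronglyMeasurable_condExp
  obtain ⟨g, hg, he⟩ := hsm.measurable.exists_eq_measurable_comp
  set S := {ω' | Y ω' = Y ω} with hS
  have hSm : MeasurableSet[MeasurableSpace.comap Y inferInstance] S :=
    ⟨{Y ω}, MeasurableSet.singleton _, by ext; simp [hS]⟩
  have h1 := setIntegral_condExp hm hf hSm
  have h2 : ∫ x in S, (μ[f | MeasurableSpace.comap Y inferInstance]) x ∂μ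
      = ∫ x in S, (μ[f | MeasurableSpace.comap Y inferInstance]) ω ∂μ := by
    refine setIntegral_congr_fun (hm _ hSm) fun x hx => ?_
    have hx' : Y x = Y ω := hx
    simp only [he, Function.comp_apply, hx']
  rw [h2, setIntegral_const] at h1
  have h3 : ∫ ω', (if Y ω' = Y ω then f ω' else 0) ∂μ = ∫ x in S, f x ∂μ := by
    rw [← integral_indicator (hm _ hSm)]
    refine integral_congr_ae (Eventually.of_forall fun x => ?_)
    simp [indicator_apply, hS]
  rw [h3, ← h1, smul_eq_mul, Measure.real]
  have : (μ S).toReal ≠ 0 := ENNReal.toReal_ne_zero.2 ⟨h, measure_ne_top _ _⟩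
  field_simp

lemma progC_of_progMeas {F : ℝ → MeasurableSpace Ω} {η : ℝ → Ω → ℝ} (h : ProgMeas F η) :
    ProgC F (fun s ω => η (max s 0) ω) := by
  intro t ht
  letI := F t
  have h1 := h t ht
  have h2 : Measurable (fun p : ℝ × Ω =>
      ((⟨max (min p.1 t) 0, le_max_right _ _, max_le (min_le_right _ _) ht⟩ : Icc (0:ℝ) t), p.2)) := by
    refine Measurable.prodMk (Measurable.subtype_mk ?_) measurable_snd
    exact (measurable_fst.min measurable_const).max measurable_const
  exact h1.comp h2

lemma clip_div_bounds {L U : ℝ} (hL : 0 < L) {x y z : ℝ} (hx : L ≤ x ∧ x ≤ U)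
    (hy : L ≤ y ∧ y ≤ U) (hz : L ≤ z ∧ z ≤ U) : L / U * L ≤ x / y * z ∧ x / y * z ≤ U / L * U := by
  have hy0 : 0 < y := hL.trans_le hy.1
  have hx0 : 0 < x := hL.trans_le hx.1
  have hU0 : 0 < U := hx0.trans_le hx.2
  constructor
  · exact mul_le_mul (div_le_div₀ hx0.le hx.1 hy0 hy.2) hz.1 hL.le (by positivity)
  · exact mul_le_mul (div_le_div₀ hU0.le hx.2 hL hy.1) hz.2 (hL.le.trans hz.1) (by positivity)

lemma exists_rate {m0 : MeasurableSpace Ω} (μ : Measure Ω) [IsProbabilityMeasure μ]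
    (F : ℝ → MeasurableSpace Ω) (hUC : UsualConditions μ F)
    (L U : ℝ) (hL : 0 < L) (hLU : L < U)
    (η : ℝ → Ω → ℝ) (hη_prog : ProgMeas F η)
    (hη_bdd : ∀ᵐ p ∂(μ.prod (volume.restrict (Set.Ici (0:ℝ)))),
      L ≤ η p.2 p.1 ∧ η p.2 p.1 ≤ U)
    (lam : ℝ → ℕ → ℝ) (hlam_meas : ∀ x : ℕ, Measurable (fun t => lam t x))
    (hlam_bdd : ∀ x : ℕ, ∀ᵐ t ∂(volume.restrict (Set.Ici (0:ℝ))),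
      L ≤ lam t x ∧ lam t x ≤ U)
    (τ τ' : ℕ → Ω → ℝ) (hτ' : GoodT τ') (hτm' : ∀ k, Measurable (τ' k))
    (hN : ∀ᵐ ω ∂μ, ∀ t, countXminus τ t ω = countXminus τ' t ω)
    (γ : ℕ → ℝ → ℝ)
    (hγ : ∀ (k : ℕ) (t : ℝ), γ k t =
      (∫ ω, (if countXminus τ t ω = k then η t ω else 0) ∂μ) /
        (μ {ω | countXminus τ t ω = k}).toReal) :
    ∃ (c : ℕ → ℝ → Ω → ℝ) (a K : ℝ), 0 < a ∧ 0 < K ∧ (∀ k, ProgC F (c k)) ∧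
      (∀ k t ω, a ≤ c k t ω) ∧ (∀ k t ω, c k t ω ≤ K) ∧
      ∀ᵐ ω ∂μ, ∀ᵐ s ∂(volume.restrict (Set.Ici (0:ℝ))),
        η s ω / (μ[η s | MeasurableSpace.comap (countXminus τ s) inferInstance]) ω *
            lam s (countXminus τ s ω) = c (countXminus τ s ω) s ω ∧
        η s ω / γ (countXminus τ s ω) s * lam s (countXminus τ s ω) =
          c (countXminus τ s ω) s ω := by
  have hnull0 : ∀ s : Set Ω, μ s = 0 → MeasurableSet[m0] s := fun s hs => hUC.1.2 0 _ (hUC.2.2 s hs)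
  have hJ := measurable_countXminus_joint hτ' hτm'
  have hηP := progC_of_progMeas hη_prog
  have hηJ := hηP.measurable hUC.1
  set clip : ℝ → ℝ := fun x => max L (min U x) with hclip
  have hclipm : Measurable clip := measurable_const.max (measurable_const.min measurable_id)
  have hclipb : ∀ x, L ≤ clip x ∧ clip x ≤ U := fun x =>
    ⟨le_max_left _ _, max_le hLU.le (min_le_left _ _)⟩
  have hclipe : ∀ x, L ≤ x → x ≤ U → clip x = x := fun x h1 h2 => by
    simp [hclip, h1, h2]
  have hγ' : ∀ k t, γ k t = (∫ ω, (if countXminus τ' t ω = k then η t ω else 0) ∂μ) /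
        (μ {ω | countXminus τ' t ω = k}).toReal := by
    intro k t
    rw [hγ]
    congr 1
    · refine integral_congr_ae ?_
      filter_upwards [hN] with ω hω
      rw [hω]
    · congr 1
      refine measure_congr ?_
      filter_upwards [hN] with ω hω
      change (countXminus τ t ω = k) = (countXminus τ' t ω = k)
      rw [hω]
  have hmaxm : Measurable (fun p : ℝ × Ω => (max p.1 0, p.2)) :=
    (measurable_fst.max measurable_const).prodMk measurable_snd
  have hSk : ∀ k, MeasurableSet {p : ℝ × Ω | countXminus τ' p.1 p.2 = k} := fun k =>
    hJ (MeasurableSet.singleton k)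
  have hμk : ∀ k, Measurable (fun s => μ {ω | countXminus τ' s ω = k}) := fun k =>
    measurable_measure_prodMk_left (hSk k)
  have hγm : ∀ k, Measurable (fun s => γ k (max s 0)) := by
    intro k
    simp only [hγ']
    refine Measurable.div ?_ ?_
    · have h1 : Measurable (fun p : ℝ × Ω =>
          if countXminus τ' (max p.1 0) p.2 = k then η (max p.1 0) p.2 else 0) :=
        Measurable.ite (hmaxm (hSk k)) hηJ measurable_const
      exact (h1.stronglyMeasurable.integral_prod_right' (ν := μ)).measurable
    · exact ((hμk k).comp (measurable_id.max measurable_const)).ennreal_toReal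
  refine ⟨fun k s ω => clip (η (max s 0) ω) / clip (γ k (max s 0)) * clip (lam s k),
    L / U * L, U / L * U, ?_, ?_, ?_, ?_, ?_, ?_⟩
  · have := hL.trans hLU; positivity
  · have := hL.trans hLU; positivity
  · intro k t ht
    letI := F t
    have h1 := hηP t ht
    have hm : Measurable (fun p : ℝ × Ω => min p.1 t) := measurable_fst.min measurable_const
    exact ((hclipm.comp h1).div (hclipm.comp ((hγm k).comp hm))).mul
      (hclipm.comp ((hlam_meas k).comp hm))
  · exact fun k t ω => (clip_div_bounds hL (hclipb _) (hclipb _) (hclipb _)).1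
  · exact fun k t ω => (clip_div_bounds hL (hclipb _) (hclipb _) (hclipb _)).2
  · -- a.e. identification
    have hb := Measure.ae_ae_of_ae_prod hη_bdd
    have hsw : ∀ᵐ p ∂((volume.restrict (Set.Ici (0:ℝ))).prod μ), L ≤ η p.1 p.2 ∧ η p.1 p.2 ≤ U :=
      (Measure.measurePreserving_swap (μ := volume.restrict (Set.Ici (0:ℝ)))
        (ν := μ)).quasiMeasurePreserving.ae hη_bdd
    have ha := Measure.ae_ae_of_ae_prod hsw
    have hl : ∀ᵐ s ∂(volume.restrict (Set.Ici (0:ℝ))), ∀ x, L ≤ lam s x ∧ lam s x ≤ U :=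
      ae_all_iff.2 hlam_bdd
    have hd : ∀ᵐ ω ∂μ, ∀ᵐ s ∂(volume.restrict (Set.Ici (0:ℝ))),
        μ {ω' | countXminus τ' s ω' = countXminus τ' s ω} ≠ 0 := by
      have hM : Measurable (fun p : ℝ × Ω =>
          μ {ω' | countXminus τ' p.1 ω' = countXminus τ' p.1 p.2}) :=
        (measurable_from_prod_countable_right
          (f := fun q : ℕ × (ℝ × Ω) => μ {ω' | countXminus τ' q.2.1 ω' = q.1})
          (fun k => (hμk k).comp measurable_fst)).comp (hJ.prodMk measurable_id)
      have hD : MeasurableSet {p : Ω × ℝ |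
          μ {ω' | countXminus τ' p.2 ω' = countXminus τ' p.2 p.1} ≠ 0} :=
        (hM.comp measurable_swap) (MeasurableSet.singleton (0:ℝ≥0∞)).compl
      rw [Measure.ae_ae_comm hD]
      refine Eventually.of_forall fun s => ?_
      have : ∀ᵐ ω ∂μ, ∀ k : ℕ, μ {ω' | countXminus τ' s ω' = k} = 0 → countXminus τ' s ω ≠ k := by
        rw [ae_all_iff]
        intro k
        by_cases hk : μ {ω' | countXminus τ' s ω' = k} = 0
        · have : ∀ᵐ ω ∂μ, countXminus τ' s ω ≠ k := by
            rw [ae_iff]; simpa using hk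
          filter_upwards [this] with ω h _ using h
        · exact Eventually.of_forall fun ω h => absurd h hk
      filter_upwards [this] with ω h h0
      exact h _ h0 rfl
    filter_upwards [hb, hd, hN] with ω hbω hdω hNω
    filter_upwards [hbω, hdω, hl, ha, ae_restrict_mem measurableSet_Ici] with s h1 h2 h3 h4 hs
    have hs : 0 ≤ s := hs
    have hms : max s 0 = s := max_eq_left hs
    set k := countXminus τ s ω with hk
    have hk' : countXminus τ' s ω = k := by rw [hk, hNω]
    rw [hk'] at h2
    have hηs : Measurable (η s) := by
      have h := (hηP.measurable_at hs).mono (hUC.1.2 s) le_rfl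
      simpa only [hms] using h
    have hηi : Integrable (η s) μ := by
      refine Integrable.of_bound hηs.aestronglyMeasurable U ?_
      filter_upwards [h4] with ω' h
      rw [Real.norm_eq_abs, abs_of_nonneg (hL.le.trans h.1)]
      exact h.2
    have hYm' : Measurable (countXminus τ' s) := hJ.comp measurable_prodMk_left
    have hYm : Measurable (countXminus τ s) := by
      refine measurable_of_ae_eq_sub μ hnull0 hYm' ?_
      filter_upwards [hN] with ω' h using h s
    have hset : μ {ω' | countXminus τ s ω' = k} = μ {ω' | countXminus τ' s ω' = k} := by
      refine measure_congr ?_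
      filter_upwards [hN] with ω' h
      change (countXminus τ s ω' = k) = (countXminus τ' s ω' = k)
      rw [h]
    have hce := condExp_atom μ (countXminus τ s) hYm (η s) hηi ω (by rw [← hk, hset]; exact h2)
    rw [← hk, ← hγ] at hce
    have hγb : L ≤ γ k s ∧ γ k s ≤ U := by
      have hSm : MeasurableSet {ω' | countXminus τ' s ω' = k} := hYm' (MeasurableSet.singleton k)
      have hpos : 0 < (μ {ω' | countXminus τ' s ω' = k}).toReal :=
        ENNReal.toReal_pos h2 (measure_ne_top _ _)
      have e : ∫ ω', (if countXminus τ' s ω' = k then η s ω' else 0) ∂μ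
          = ∫ x in {ω' | countXminus τ' s ω' = k}, η s x ∂μ := by
        rw [← integral_indicator hSm]
        refine integral_congr_ae (Eventually.of_forall fun x => ?_)
        simp [indicator_apply]
      rw [hγ', e, le_div_iff₀ hpos, div_le_iff₀ hpos]
      constructor
      · have := setIntegral_mono_ae (μ := μ) (s := {ω' | countXminus τ' s ω' = k})
          (f := fun _ => L) (g := η s) (integrable_const _).integrableOn hηi.integrableOn
          (by filter_upwards [h4] with x hx using hx.1)
        rw [setIntegral_const, smul_eq_mul, Measure.real, mul_comm] at this
        exact this
      · have := setIntegral_mono_ae (μ := μ) (s := {ω' | countXminus τ' s ω' = k})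
          (g := fun _ => U) (f := η s) hηi.integrableOn (integrable_const _).integrableOn
          (by filter_upwards [h4] with x hx using hx.2)
        rw [setIntegral_const, smul_eq_mul, Measure.real, mul_comm] at this
        exact this
    rw [hce, hms, hclipe _ h1.1 h1.2, hclipe _ hγb.1 hγb.2, hclipe _ (h3 k).1 (h3 k).2]
    exact ⟨rfl, rfl⟩

lemma countX_congr {τ τ' : ℕ → Ω → ℝ} {ω : Ω} (h : ∀ k, τ k ω = τ' k ω) (t : ℝ) :
    countX τ t ω = countX τ' t ω := by
  simp only [countX, h]

lemma countXminus_congr {τ τ' : ℕ → Ω → ℝ} {ω : Ω} (h : ∀ k, τ k ω = τ' k ω) (t : ℝ) :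
    countXminus τ t ω = countXminus τ' t ω := by
  simp only [countXminus, h]

lemma ProgC.measurable_Finfty {H : ℝ → MeasurableSpace Ω} {c : ℝ → Ω → ℝ} (hc : ProgC H c) :
    Measurable[MeasurableSpace.prod inferInstance (Finfty H)] (fun p : ℝ × Ω => c p.1 p.2) := by
  refine @measurable_of_tendsto_metrizable (ℝ × Ω) ℝ
    (MeasurableSpace.prod inferInstance (Finfty H)) _ _ _ _
    (fun n : ℕ => fun p : ℝ × Ω => c (min p.1 n) p.2) _ ?_ ?_
  · intro n
    have h := hc n (by positivity)
    exact h.mono (sup_le_sup le_rfl (MeasurableSpace.comap_mono (le_Finfty H (by positivity)))) le_rfl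
  · rw [tendsto_pi_nhds]
    intro p
    refine tendsto_const_nhds.congr' ?_
    obtain ⟨n, hn⟩ := exists_nat_ge p.1
    filter_upwards [eventually_ge_atTop n] with m hm
    rw [min_eq_left (hn.trans (by exact_mod_cast hm))]

lemma measurable_integral_between [MeasurableSpace Ω] {c : ℝ → Ω → ℝ}
    (hc : Measurable (fun p : ℝ × Ω => c p.1 p.2)) {a b : Ω → ℝ} (ha : Measurable a)
    (hb : Measurable b) : Measurable (fun ω => ∫ u in Ioc (a ω) (b ω), c u ω) := by
  have h1 : Measurable (fun p : ℝ × Ω => if a p.2 < p.1 ∧ p.1 ≤ b p.2 then c p.1 p.2 else 0) := by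
    refine Measurable.ite ?_ hc measurable_const
    exact (measurableSet_lt (ha.comp measurable_snd) measurable_fst).inter
      (measurableSet_le measurable_fst (hb.comp measurable_snd))
  have h2 := measurable_param_integral h1 univ
  refine Eq.mp ?_ h2
  congr 1
  ext ω
  rw [Measure.restrict_univ, ← integral_indicator measurableSet_Ioc]
  refine integral_congr_ae (Eventually.of_forall fun u => ?_)
  simp [indicator_apply]

lemma assemble {m0 : MeasurableSpace Ω} (μ : Measure Ω) [IsProbabilityMeasure μ]
    (F : ℝ → MeasurableSpace Ω) (hUC : UsualConditions μ F)
    (τ : ℕ → Ω → ℝ) (hτ0 : ∀ ω, τ 0 ω = 0)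
    (hτincr : ∀ᵐ ω ∂μ, (0 < τ 1 ω) ∧ StrictMono (fun k => τ k ω) ∧
      Tendsto (fun k => τ k ω) atTop atTop)
    (τ' : ℕ → Ω → ℝ) (hτ' : GoodT τ') (hττ' : ∀ᵐ ω ∂μ, ∀ k, τ k ω = τ' k ω)
    (G : ℕ → ℝ → MeasurableSpace Ω)
    (hG : ∀ k : ℕ, G k = rcReg (fun t => F t ⊔
      ⨆ i ∈ Finset.range k, natFilt (fun s ω => if τ (i + 1) ω ≤ s then (1:ℝ) else 0) t))
    (Gi : ℝ → MeasurableSpace Ω)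
    (hGi : Gi = rcReg (fun t => F t ⊔
      ⨆ i : ℕ, natFilt (fun s ω => if τ (i + 1) ω ≤ s then (1:ℝ) else 0) t))
    (himm : ∀ k : ℕ, Immersed μ (G k) (G (k + 1)))
    (himmGi : ∀ k : ℕ, Immersed μ (G k) Gi)
    (hZ : ∀ k : ℕ, ∃ Z : ℝ → Ω → ℝ,
      (∀ ω, Continuous fun t => Z t ω) ∧ (∀ t ω, 0 < Z t ω) ∧
      ∀ t : ℝ, 0 ≤ t →
        Z t =ᵐ[μ] μ[(fun ω => if t < τ (k + 1) ω then (1:ℝ) else 0) | G k t])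
    (c : ℕ → ℝ → Ω → ℝ) (a K : ℝ) (ha : 0 < a) (hK : 0 < K) (hcp : ∀ k, ProgC F (c k))
    (hca : ∀ k t ω, a ≤ c k t ω) (hcK : ∀ k t ω, c k t ω ≤ K)
    (q : ℝ → Ω → ℝ) (r : ℕ → ℝ → Ω → ℝ)
    (hqr : ∀ᵐ ω ∂μ, ∀ᵐ s ∂(volume.restrict (Set.Ici (0:ℝ))),
      q s ω = c (countXminus τ s ω) s ω ∧
      r (countXminus τ s ω) s ω = c (countXminus τ s ω) s ω)
    (hmart : IsMartingale μ Gi (fun t ω => (countX τ t ω : ℝ) - ∫ s in Set.Ioc 0 t, q s ω))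
    (Ek : ℕ → Ω → ℝ)
    (hEk : ∀ (k : ℕ) (ω : Ω), Ek k ω = ∫ s in Set.Ioc (τ k ω) (τ (k + 1) ω), r k s ω) :
    (∀ k : ℕ, IsExpOne μ (Ek k)) ∧
    iIndep (fun i : Option ℕ =>
      Option.elim i (Finfty F)
        (fun k => MeasurableSpace.comap (Ek k) inferInstance)) μ ∧
    ∀ᵐ ω ∂μ, ∀ k : ℕ, τ (k + 1) ω =
      sInf {t : ℝ | τ k ω < t ∧ Ek k ω ≤ ∫ s in Set.Ioc (τ k ω) t, r k s ω} := by
  have hnull0 : ∀ s : Set Ω, μ s = 0 → MeasurableSet[m0] s := fun s hs => hUC.1.2 0 _ (hUC.2.2 s hs)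
  obtain ⟨hGU, hτm, hGim, hGile, hGinull, hτGi, hτG, hFG⟩ :=
    setup_facts μ F hUC τ hτ0 hτincr G hG Gi hGi hZ
  have hbad : μ {ω | ¬ ∀ k, τ k ω = τ' k ω} = 0 := hττ'
  have hτm' : ∀ k, Measurable (τ' k) := fun k => by
    refine measurable_of_ae_eq_sub μ hnull0 (hτm k) ?_
    filter_upwards [hττ'] with ω h using (h k).symm
  have hGinull' : ∀ t, 0 ≤ t → ∀ s, μ s = 0 → MeasurableSet[Gi t] s := fun t ht s hs =>
    hGim 0 t le_rfl ht _ (hGinull s hs)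
  have hGnull' : ∀ k t, 0 ≤ t → ∀ s, μ s = 0 → MeasurableSet[G k t] s := fun k t ht s hs =>
    (hGU k).1.1 0 t le_rfl ht _ ((hGU k).2.2 s hs)
  have hset : ∀ k (q : ℝ) ω, ω ∉ {ω | ¬ ∀ k, τ k ω = τ' k ω} →
      (ω ∈ {ω | τ' k ω ≤ q} ↔ ω ∈ {ω | τ k ω ≤ q}) := by
    intro k q ω h
    have h : ∀ k, τ k ω = τ' k ω := not_not.1 h
    simp [h k]
  have hτGi' : ∀ k t, 0 ≤ t → MeasurableSet[Gi t] {ω | τ' k ω ≤ t} := fun k t ht =>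
    measurableSet_of_ae_eq_sub μ (hGinull' t ht) hbad (hτGi k t t ht le_rfl) (hset k t)
  have hτG' : ∀ k q t, 0 ≤ t → q ≤ t → MeasurableSet[G k t] {ω | τ' k ω ≤ q} := fun k q t ht hq =>
    measurableSet_of_ae_eq_sub μ (hGnull' k t ht) hbad (hτG k k q t le_rfl ht hq) (hset k q)
  have hZ' : ∀ k : ℕ, ∃ Z : ℝ → Ω → ℝ,
      (∀ ω, Continuous fun t => Z t ω) ∧ (∀ t ω, 0 < Z t ω) ∧
      ∀ t : ℝ, 0 ≤ t →
        Z t =ᵐ[μ] μ[{ω | t < τ' (k+1) ω}.indicator (fun _ => (1:ℝ)) | G k t] := by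
    intro k
    obtain ⟨Z, h1, h2, h3⟩ := hZ k
    refine ⟨Z, h1, h2, fun t ht => (h3 t ht).trans (condExp_congr_ae ?_)⟩
    filter_upwards [hττ'] with ω h
    simp [indicator_apply, h (k+1)]
  have hcpG : ∀ k j, ProgC (G j) (c k) := fun k j t ht =>
    (hcp k t ht).mono (sup_le_sup le_rfl (MeasurableSpace.comap_mono (hFG j t ht))) le_rfl
  have hcm : ∀ k, Measurable (fun p : ℝ × Ω => c k p.1 p.2) := fun k => (hcp k).measurable hUC.1
  have hJ := measurable_countXminus_joint hτ' hτm'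
  have hCJ : Measurable (fun p : ℝ × Ω => c (countXminus τ' p.1 p.2) p.1 p.2) :=
    measurable_comp_idx hJ hcm
  have hc0 : ∀ k t ω, 0 ≤ c k t ω := fun k t ω => ha.le.trans (hca k t ω)
  have hcabs : ∀ k t ω, ‖c k t ω‖ ≤ K := fun k t ω => by
    rw [Real.norm_eq_abs, abs_of_nonneg (hc0 k t ω)]; exact hcK k t ω
  -- the compensator
  set A : ℝ → Ω → ℝ := fun t ω => ∫ u in Ioc 0 t, c (countXminus τ' u ω) u ω with hAdef
  have hCi : ∀ ω (x y : ℝ), IntegrableOn (fun u => c (countXminus τ' u ω) u ω) (Ioc x y) := by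
    intro ω x y
    refine Integrable.of_bound (hCJ.comp measurable_prodMk_right).aestronglyMeasurable K ?_
    exact Eventually.of_forall fun u => hcabs _ _ _
  have hci : ∀ k ω (x y : ℝ), IntegrableOn (fun u => c k u ω) (Ioc x y) := by
    intro k ω x y
    refine Integrable.of_bound ((hcm k).comp measurable_prodMk_right).aestronglyMeasurable K ?_
    exact Eventually.of_forall fun u => hcabs _ _ _
  have hAm : ∀ t, Measurable (A t) := fun t => measurable_param_integral hCJ (Ioc 0 t)
  have hAi : ∀ t, Integrable (A t) μ := by
    intro t
    refine Integrable.of_bound (hAm t).aestronglyMeasurable (K * volume.real (Ioc 0 t)) ?_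
    refine Eventually.of_forall fun ω => ?_
    exact norm_setIntegral_le_of_norm_le_const (by simp) fun u _ => hcabs _ _ _
  have hMA : ∀ t, 0 ≤ t → (fun ω => (countX τ t ω : ℝ) - ∫ s in Set.Ioc 0 t, q s ω) =ᵐ[μ]
      fun ω => (countX τ' t ω : ℝ) - A t ω := by
    intro t ht
    filter_upwards [hττ', hqr] with ω h1 h2
    rw [countX_congr h1]
    congr 1
    refine setIntegral_congr_ae measurableSet_Ioc ?_
    rw [ae_restrict_iff' measurableSet_Ici] at h2
    filter_upwards [h2] with s hs hs2
    rw [(hs hs2.1.le).1, countXminus_congr h1]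
  obtain ⟨hM1, hM2, hM3⟩ := hmart
  have hXi : ∀ t, 0 ≤ t → Integrable (fun ω => (countX τ' t ω : ℝ)) μ := by
    intro t ht
    have h1 := (hM1 t ht).congr (hMA t ht)
    refine (h1.add (hAi t)).congr (Eventually.of_forall fun ω => ?_)
    simp
  have hX : ∀ s t, 0 ≤ s → s ≤ t → ∀ B, MeasurableSet[Gi s] B →
      ∫ ω in B, ((countX τ' t ω : ℝ) - countX τ' s ω) ∂μ =
        ∫ ω in B, (∫ u in Ioc s t, c (countXminus τ' u ω) u ω) ∂μ := by
    intro s t hs hst B hB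
    have ht := hs.trans hst
    have h1 := setIntegral_condExp (hGile s hs) (hM1 t ht) hB
    have h2 : ∀ t, 0 ≤ t → ∫ ω in B, ((countX τ t ω : ℝ) - ∫ s in Set.Ioc 0 t, q s ω) ∂μ
        = ∫ ω in B, (countX τ' t ω : ℝ) ∂μ - ∫ ω in B, A t ω ∂μ := by
      intro t ht
      rw [integral_congr_ae (ae_restrict_of_ae (hMA t ht)), integral_sub (hXi t ht).integrableOn
        (hAi t).integrableOn]
    have h3 := integral_congr_ae (ae_restrict_of_ae (s := B) (hM3 s t hs hst))
    rw [h1, h2 t ht, h2 s hs] at h3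
    rw [integral_sub (hXi t ht).integrableOn (hXi s hs).integrableOn]
    have h4 : ∫ ω in B, (∫ u in Ioc s t, c (countXminus τ' u ω) u ω) ∂μ
        = ∫ ω in B, (A t ω - A s ω) ∂μ := by
      refine integral_congr_ae (Eventually.of_forall fun ω => ?_)
      simp only [hAdef]
      rw [← Ioc_union_Ioc_eq_Ioc hs hst, setIntegral_union (Ioc_disjoint_Ioc_of_le le_rfl)
        measurableSet_Ioc (hCi _ _ _) (hCi _ _ _)]
      ring
    rw [h4, integral_sub (hAi t).integrableOn (hAi s).integrableOn]
    linarith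
  have hcore := core μ G hGU hGim hGile himmGi τ' hτ' hτm' hτGi' hτG' hZ' c a K ha hK
    (fun k => hcpG k k) hca hcK hXi hX
  have hτnn : ∀ ω j, 0 ≤ τ' j ω := fun ω j => by
    have := (hτ' ω).2.1.monotone (Nat.zero_le j)
    simpa [(hτ' ω).1] using this
  -- identification of the integrals
  have hr : ∀ᵐ ω ∂μ, ∀ k, ∀ t, t ≤ τ' (k+1) ω →
      ∫ s in Ioc (τ' k ω) t, r k s ω = ∫ s in Ioc (τ' k ω) t, c k s ω := by
    filter_upwards [hττ', hqr] with ω h1 h2 k t ht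
    refine setIntegral_congr_ae measurableSet_Ioc ?_
    rw [ae_restrict_iff' measurableSet_Ici] at h2
    filter_upwards [h2] with s hs hs2
    have e : countXminus τ s ω = k := by
      rw [countXminus_congr h1]
      exact countXminus_eq (hτ' ω).2.1 hs2.1 (hs2.2.trans ht)
    have := (hs ((hτnn ω k).trans hs2.1.le)).2
    rwa [e] at this
  have hEe : ∀ᵐ ω ∂μ, ∀ k, Ek k ω = ∫ s in Ioc (τ' k ω) (τ' (k+1) ω), c k s ω := by
    filter_upwards [hττ', hr] with ω h1 h2 k
    rw [hEk, h1 k, h1 (k+1), h2 k _ le_rfl]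
  have hE : ∀ k s, 0 ≤ s → ∀ A, MeasurableSet[G k s] A → ∀ x, 0 ≤ x →
      μ (A ∩ {ω | x < Ek k ω}) = μ A * ENNReal.ofReal (Real.exp (-x)) := by
    intro k s hs A hA x hx
    rw [← hcore k s hs A hA x hx]
    refine measure_congr ?_
    filter_upwards [hEe] with ω h
    change (ω ∈ A ∧ x < Ek k ω) = (ω ∈ A ∧ x < _)
    rw [h k]
  have hEm : ∀ k, Measurable[Finfty (G (k+1))] (Ek k) := by
    intro k
    have hn : ∀ s, μ s = 0 → MeasurableSet[Finfty (G (k+1))] s := fun s hs =>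
      le_Finfty (G (k+1)) le_rfl _ ((hGU (k+1)).2.2 s hs)
    have hτF : ∀ i, i ≤ k + 1 → Measurable[Finfty (G (k+1))] (τ' i) := by
      intro i hi
      refine measurable_of_ae_eq_sub μ hn (g := τ i) ?_ ?_
      · refine @measurable_of_Iic ℝ Ω _ _ _ (Finfty (G (k+1))) _ _ _ _ fun x => ?_
        exact le_Finfty (G (k+1)) (le_max_right x 0) _
          (hτG (k+1) i x (max x 0) hi (le_max_right _ _) (le_max_left _ _))
      · filter_upwards [hττ'] with ω h using (h i).symm
    refine measurable_of_ae_eq_sub μ hn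
      (g := fun ω => ∫ s in Ioc (τ' k ω) (τ' (k+1) ω), c k s ω) ?_ ?_
    · exact @measurable_integral_between Ω (Finfty (G (k+1))) _ (hcpG k (k+1)).measurable_Finfty _ _
        (hτF k (Nat.le_succ k)) (hτF (k+1) le_rfl)
    · filter_upwards [hEe] with ω h using h k
  refine ⟨fun k => ⟨?_, fun x hx => ?_⟩, ?_, ?_⟩
  · refine (hEm k).mono ?_ le_rfl
    exact iSup₂_le fun t _ => (hGU (k+1)).1.2 t
  · have := hE k 0 le_rfl univ MeasurableSet.univ x hx
    simpa using this
  · exact indep_concl μ F G (fun k => (hGU k).1) (fun t ht => hFG 0 t ht)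
      (fun k t ht => (himm k).1 t ht) Ek hEm hE
  · filter_upwards [hττ', hr, hEe] with ω h1 h2 h3 k
    symm
    refine IsLeast.csInf_eq ⟨⟨?_, ?_⟩, ?_⟩
    · rw [h1, h1]; exact (hτ' ω).2.1 (Nat.lt_succ_self k)
    · rw [hEk]
    · rintro t ⟨ht1, ht2⟩
      by_contra hlt
      rw [not_le] at hlt
      rw [h1] at ht1 hlt
      rw [h1 k, h3 k, h2 k t hlt.le, ← Ioc_union_Ioc_eq_Ioc ht1.le hlt.le,
        setIntegral_union (Ioc_disjoint_Ioc_of_le le_rfl)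
        measurableSet_Ioc (hci _ _ _ _) (hci _ _ _ _)] at ht2
      have h5 : a * (τ' (k+1) ω - t) ≤ ∫ s in Ioc t (τ' (k+1) ω), c k s ω := by
        have := setIntegral_mono (μ := volume) (s := Ioc t (τ' (k+1) ω))
          (f := fun _ => a) (g := fun s => c k s ω) (integrableOn_const (by simp))
          (hci _ _ _ _) (fun s => hca k s ω)
        rw [setIntegral_const, smul_eq_mul, Real.volume_real_Ioc_of_le hlt.le, mul_comm] at this
        exact this
      have := mul_pos ha (sub_pos.2 hlt)
      linarith

/-- Under the immersion chain and the regularity of the Azéma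
supermartingales `Z^k`, any counting process with compensator
`(η_t / E[η_t | X_{t-}]) λ(t, X_{t-}) dt` arises from a Cox construction: the random
variables `E_k = ∫_{τ_{k-1}}^{τ_k} (η_s/γ_{k-1}(s)) λ(s,k−1) ds` are i.i.d. `Exp(1)`,
independent of `F_∞`, and a.s. `τ_k = inf{t > τ_{k-1} : ∫_{τ_{k-1}}^t (η_s/γ_{k-1}(s)) λ(s,k−1) ds ≥ E_k}`. -/
theorem cox_structure_of_inversion
    {m0 : MeasurableSpace Ω} (μ : Measure Ω) [IsProbabilityMeasure μ]
    (F : ℝ → MeasurableSpace Ω) (hUC : UsualConditions μ F)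
    (L U : ℝ) (hL : 0 < L) (hLU : L < U)
    (η : ℝ → Ω → ℝ) (hη_prog : ProgMeas F η)
    (hη_bdd : ∀ᵐ p ∂(μ.prod (volume.restrict (Set.Ici (0:ℝ)))),
      L ≤ η p.2 p.1 ∧ η p.2 p.1 ≤ U)
    (lam : ℝ → ℕ → ℝ) (hlam_meas : ∀ x : ℕ, Measurable (fun t => lam t x))
    (hlam_bdd : ∀ x : ℕ, ∀ᵐ t ∂(volume.restrict (Set.Ici (0:ℝ))),
      L ≤ lam t x ∧ lam t x ≤ U)
    (τ : ℕ → Ω → ℝ) (hτ0 : ∀ ω, τ 0 ω = 0)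
    (hτincr : ∀ᵐ ω ∂μ, (0 < τ 1 ω) ∧ StrictMono (fun k => τ k ω) ∧
      Tendsto (fun k => τ k ω) atTop atTop)
    (G : ℕ → ℝ → MeasurableSpace Ω)
    (hG : ∀ k : ℕ, G k = rcReg (fun t => F t ⊔
      ⨆ i ∈ Finset.range k, natFilt (fun s ω => if τ (i + 1) ω ≤ s then (1:ℝ) else 0) t))
    (Gi : ℝ → MeasurableSpace Ω)
    (hGi : Gi = rcReg (fun t => F t ⊔
      ⨆ i : ℕ, natFilt (fun s ω => if τ (i + 1) ω ≤ s then (1:ℝ) else 0) t))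
    -- (i) the immersion chain
    (himm : ∀ k : ℕ, Immersed μ (G k) (G (k + 1)))
    (himmGi : ∀ k : ℕ, Immersed μ (G k) Gi)
    -- (ii) continuous strictly positive modifications of the Azéma supermartingales
    (hZ : ∀ k : ℕ, ∃ Z : ℝ → Ω → ℝ,
      (∀ ω, Continuous fun t => Z t ω) ∧ (∀ t ω, 0 < Z t ω) ∧
      ∀ t : ℝ, 0 ≤ t →
        Z t =ᵐ[μ] μ[(fun ω => if t < τ (k + 1) ω then (1:ℝ) else 0) | G k t])
    -- the compensated counting process is a `Gi`-martingale
    (hmart : IsMartingale μ Gi (fun t ω =>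
      (countX τ t ω : ℝ) -
        ∫ s in Set.Ioc 0 t,
          η s ω /
            (μ[η s | MeasurableSpace.comap (countXminus τ s) inferInstance]) ω *
            lam s (countXminus τ s ω)))
    -- the functions `γ_k(t) = E[η_t | X_{t-} = k]` and the random variables `E_k`
    (γ : ℕ → ℝ → ℝ)
    (hγ : ∀ (k : ℕ) (t : ℝ), γ k t =
      (∫ ω, (if countXminus τ t ω = k then η t ω else 0) ∂μ) /
        (μ {ω | countXminus τ t ω = k}).toReal)
    (Ek : ℕ → Ω → ℝ)
    (hEk : ∀ (k : ℕ) (ω : Ω), Ek k ω =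
      ∫ s in Set.Ioc (τ k ω) (τ (k + 1) ω), η s ω / γ k s * lam s k) :
    (∀ k : ℕ, IsExpOne μ (Ek k)) ∧
    iIndep (fun i : Option ℕ =>
      Option.elim i (Finfty F)
        (fun k => MeasurableSpace.comap (Ek k) inferInstance)) μ ∧
    ∀ᵐ ω ∂μ, ∀ k : ℕ, τ (k + 1) ω =
      sInf {t : ℝ | τ k ω < t ∧
        Ek k ω ≤ ∫ s in Set.Ioc (τ k ω) t, η s ω / γ k s * lam s k} := by
  obtain ⟨τ', hτ', hττ'⟩ := exists_good_tau μ τ hτ0 hτincr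
  have hτm := (setup_facts μ F hUC τ hτ0 hτincr G hG Gi hGi hZ).2.1
  have hnull0 : ∀ s : Set Ω, μ s = 0 → MeasurableSet[m0] s :=
    fun s hs => hUC.1.2 0 _ (hUC.2.2 s hs)
  have hτm' : ∀ k, Measurable (τ' k) := fun k => by
    refine measurable_of_ae_eq_sub μ hnull0 (hτm k) ?_
    filter_upwards [hττ'] with ω h using (h k).symm
  have hN : ∀ᵐ ω ∂μ, ∀ t, countXminus τ t ω = countXminus τ' t ω := by
    filter_upwards [hττ'] with ω h t using countXminus_congr h t
  obtain ⟨c, a, K, ha, hK, hcp, hca, hcK, hqr⟩ := exists_rate μ F hUC L U hL hLU η hη_prog hη_bdd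
    lam hlam_meas hlam_bdd τ τ' hτ' hτm' hN γ hγ
  exact assemble μ F hUC τ hτ0 hτincr τ' hτ' hττ' G hG Gi hGi himm himmGi hZ c a K ha hK hcp
    hca hcK
    (fun s ω => η s ω /
            (μ[η s | MeasurableSpace.comap (countXminus τ s) inferInstance]) ω *
            lam s (countXminus τ s ω))
    (fun k s ω => η s ω / γ k s * lam s k) hqr hmart Ek hEk

end InvMarkovJump
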